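/- arXiv:0902.0135 — 9 statements merged into one kernel-verified Lean document; each statement's English description precedes it below -/
import Mathlib

section
/- Let a₀, b₀ be integers with a₀ + b₀ < q, set a₁ = b₁ = q, a = a₀(q+1) − q, b = b₀(q+1) − q and d* = a + b. Assume 0 ≤ a + b ≤ q³ − 1, and assume either a + b > q, or (a + b ≤ q and a₁ ≠ 0 and b₁ ≠ 0). Then d(C((q−2)(q+1) + a, b)^⊥) = d* + q − (a₀ + b₀) = (a₀ + b₀ − 1)q. (Theorem 3.3, case 4: a₀ + b₀ < a₁ = q and b₁ = q.) -/
open scoped BigOperators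

namespace HermitianTwoPoint

/-- The affine points of the Hermitian curve `y^q + y = x^(q+1)` other than the origin. -/
def Dset (q : ℕ) (F : Type) [Field F] : Set (F × F) :=
  {P | P.2 ^ q + P.2 = P.1 ^ (q + 1) ∧ P ≠ 0}

/-- The exponent set describing a monomial basis of `L(m P∞ + n P₀)`. -/
def S (q : ℕ) (m n : ℤ) : Set (ℤ × ℤ) :=
  {ij | 0 ≤ ij.1 ∧ ij.1 ≤ (q : ℤ) ∧ (q : ℤ) * ij.1 + ((q : ℤ) + 1) * ij.2 ≤ m ∧
    -n ≤ ij.1 + ((q : ℤ) + 1) * ij.2}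

/-- Evaluation vector of the monomial `x^i y^j` at the points of `Dset`. -/
def evalVec (q : ℕ) (F : Type) [Field F] (ij : ℤ × ℤ) : ↥(Dset q F) → F :=
  fun P => (P : F × F).1 ^ ij.1 * (P : F × F).2 ^ ij.2

/-- The two-point Hermitian code `C(m,n)`. -/
noncomputable def Code (q : ℕ) (F : Type) [Field F] (m n : ℤ) :
    Submodule F (↥(Dset q F) → F) :=
  Submodule.span F (evalVec q F '' S q m n)

noncomputable instance (q : ℕ) (F : Type) [Field F] [Fintype F] : Fintype ↥(Dset q F) :=
  Fintype.ofFinite _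

/-- The dual code `C(m,n)^⊥`. -/
noncomputable def dualCode (q : ℕ) (F : Type) [Field F] [Fintype F] (m n : ℤ) :
    Set (↥(Dset q F) → F) :=
  {c | ∀ w ∈ Code q F m n, ∑ P, c P * w P = 0}

/-- Hamming weight of a word. -/
noncomputable def wt {q : ℕ} {F : Type} [Field F] (c : ↥(Dset q F) → F) : ℕ :=
  Nat.card {P // c P ≠ 0}

/-- Minimum distance of the dual code `C(m,n)^⊥`. -/
noncomputable def minDist (q : ℕ) (F : Type) [Field F] [Fintype F] (m n : ℤ) : ℕ :=
  sInf {w | ∃ c ∈ dualCode q F m n, c ≠ 0 ∧ wt c = w}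

/-- The moment of a word `c` against the monomial `x^i y^j`. -/
noncomputable def phi {q : ℕ} {F : Type} [Field F] [Fintype F] (c : ↥(Dset q F) → F)
    (i j : ℕ) : F :=
  ∑ P, c P * ((P : F × F).1 ^ i * (P : F × F).2 ^ j)

/-- Pole order at infinity. -/
def ww (q : ℕ) (a : ℕ × ℕ) : ℕ := q * a.1 + (q + 1) * a.2

lemma card_le_wt {q : ℕ} {F : Type} [Field F] [Fintype F] (c : ↥(Dset q F) → F)
    (A : Finset (ℕ × ℕ)) (g : ℕ × ℕ → ℕ × ℕ) (ρ : ℕ)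
    (hinj : ∀ a ∈ A, ∀ b ∈ A, ww q a = ww q b → a = b)
    (hlow : ∀ i j, ww q (i, j) < ρ → phi c i j = 0)
    (hg : ∀ a ∈ A, ww q a + ww q (g a) = ρ ∧ phi c (a.1 + (g a).1) (a.2 + (g a).2) ≠ 0) :
    A.card ≤ wt c := by
  classical
  let f : A → ({P // c P ≠ 0} → F) := fun a P => (P.1 : F × F).1 ^ a.1.1 * (P.1 : F × F).2 ^ a.1.2
  have hli : LinearIndependent F f := by
    rw [Fintype.linearIndependent_iff]
    intro l hl
    by_contra hcon
    push Not at hcon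
    obtain ⟨a1, ha1⟩ := hcon
    obtain ⟨a0, ha0, hmax⟩ := Finset.exists_max_image
      (Finset.univ.filter (fun a : A => l a ≠ 0)) (fun a => ww q a.1) ⟨a1, by simp [ha1]⟩
    have hl0 : l a0 ≠ 0 := by simpa using ha0
    have key : ∑ P, c P * ((∑ a, l a * ((P : F × F).1 ^ a.1.1 * (P : F × F).2 ^ a.1.2)) *
        ((P : F × F).1 ^ (g a0.1).1 * (P : F × F).2 ^ (g a0.1).2)) = 0 := by
      apply Finset.sum_eq_zero
      intro P _
      by_cases hP : c P = 0
      · simp [hP]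
      · have := congrFun hl ⟨P, hP⟩
        simp only [Finset.sum_apply, Pi.smul_apply, smul_eq_mul, Pi.zero_apply, f] at this
        rw [this]; simp
    have key2 : ∑ P, c P * ((∑ a, l a * ((P : F × F).1 ^ a.1.1 * (P : F × F).2 ^ a.1.2)) *
        ((P : F × F).1 ^ (g a0.1).1 * (P : F × F).2 ^ (g a0.1).2)) =
        ∑ a : A, l a * phi c (a.1.1 + (g a0.1).1) (a.1.2 + (g a0.1).2) := by
      simp only [phi, Finset.mul_sum, Finset.sum_mul]
      rw [Finset.sum_comm]
      refine Finset.sum_congr rfl fun a _ => Finset.sum_congr rfl fun P _ => ?_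
      rw [pow_add, pow_add]; ring
    rw [key2, Finset.sum_eq_single a0] at key
    · rcases mul_eq_zero.1 key with h | h
      · exact hl0 h
      · exact (hg a0.1 a0.2).2 h
    · intro a _ hne
      by_cases hla : l a = 0
      · simp [hla]
      · have h1 := hmax a (by simp [hla])
        have h2 : ww q a.1 ≠ ww q a0.1 := fun h => hne (Subtype.ext (hinj _ a.2 _ a0.2 h))
        have h3 := (hg a0.1 a0.2).1
        rw [hlow, mul_zero]
        have h4 : ww q (a.1.1 + (g a0.1).1, a.1.2 + (g a0.1).2) = ww q a.1 + ww q (g a0.1) := by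
          simp only [ww]; ring
        rw [h4]; omega
    · simp
  have := hli.fintype_card_le_finrank
  simpa [wt, Nat.card_eq_fintype_card] using this

lemma exists_phi_ne {q : ℕ} {F : Type} [Field F] [Fintype F] (c : ↥(Dset q F) → F)
    (hc : c ≠ 0) : ∃ i j, phi c i j ≠ 0 := by
  classical
  by_contra hcon
  push Not at hcon
  apply hc
  funext P0
  have hpoly : ∀ p r : Polynomial F,
      ∑ P, c P * (p.eval (P : F × F).1 * r.eval (P : F × F).2) = 0 := by
    intro p r
    simp only [Polynomial.eval_eq_sum_range, Finset.mul_sum, Finset.sum_mul]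
    rw [Finset.sum_comm]
    refine Finset.sum_eq_zero fun j _ => ?_
    rw [Finset.sum_comm]
    refine Finset.sum_eq_zero fun i _ => ?_
    have := hcon i j
    rw [phi] at this
    calc _ = ∑ P, (p.coeff i * r.coeff j) *
          (c P * ((P : F × F).1 ^ i * (P : F × F).2 ^ j)) :=
          Finset.sum_congr rfl fun P _ => by ring
      _ = 0 := by rw [← Finset.mul_sum, this, mul_zero]
  let L : F → Polynomial F := fun a =>
    ∏ x ∈ Finset.univ.erase a, (Polynomial.X - Polynomial.C x)
  have hL0 : ∀ a, (L a).eval a ≠ 0 := by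
    intro a
    simp only [L, Polynomial.eval_prod, Polynomial.eval_sub, Polynomial.eval_X,
      Polynomial.eval_C]
    refine Finset.prod_ne_zero_iff.2 fun x hx => sub_ne_zero.2 ?_
    exact (Finset.ne_of_mem_erase hx).symm
  have hL1 : ∀ a b, b ≠ a → (L a).eval b = 0 := by
    intro a b h
    simp only [L, Polynomial.eval_prod, Polynomial.eval_sub, Polynomial.eval_X,
      Polynomial.eval_C]
    exact Finset.prod_eq_zero (Finset.mem_erase.2 ⟨h, Finset.mem_univ _⟩) (sub_self b)
  have h := hpoly (L (P0 : F × F).1) (L (P0 : F × F).2)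
  rw [Finset.sum_eq_single P0] at h
  · simpa [hL0] using h
  · intro P _ hne
    by_cases h1 : (P : F × F).1 = (P0 : F × F).1
    · have h2 : (P : F × F).2 ≠ (P0 : F × F).2 := fun h2 => hne (Subtype.ext (Prod.ext h1 h2))
      rw [hL1 _ _ h2]; simp
    · rw [hL1 _ _ h1]; simp
  · simp

lemma phi_rel {q : ℕ} {F : Type} [Field F] [Fintype F] (c : ↥(Dset q F) → F) (i j : ℕ) :
    phi c (i + (q + 1)) j = phi c i (j + q) + phi c i (j + 1) := by
  simp only [phi, ← Finset.sum_add_distrib]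
  refine Finset.sum_congr rfl fun P _ => ?_
  rw [pow_add, ← P.2.1]; ring

lemma ww_inj {q : ℕ} {a b : ℕ × ℕ} (ha : a.1 ≤ q) (hb : b.1 ≤ q) (h : ww q a = ww q b) :
    a = b := by
  obtain ⟨i, j⟩ := a
  obtain ⟨k, l⟩ := b
  simp only [ww] at *
  have h2 : (q : ℤ) * i + (q + 1) * j = q * k + (q + 1) * l := by exact_mod_cast h
  have h3 : ((q : ℤ) + 1) * ((i + j) - (k + l)) = i - k := by linear_combination h2
  have h4 : ((i : ℤ) + j) - (k + l) = 0 := by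
    by_contra hne
    rcases lt_or_gt_of_ne hne with h5 | h5
    · nlinarith
    · nlinarith
  rw [h4] at h3
  have : i = k := by omega
  have : j = l := by omega
  simp [*]

/-- The Feng–Rao lower bound. -/
lemma lower {q : ℕ} {F : Type} [Field F] [Fintype F] (t : ℕ) (ht : t + 2 < q)
    (c : ↥(Dset q F) → F) (hc : c ≠ 0)
    (ho : ∀ i j : ℕ, i ≤ q → q * i + (q + 1) * j + q < q * (q + t) + t → phi c i j = 0) :
    (t + 1) * q ≤ wt c := by
  classical
  have hex : ∃ n, ∃ i j, ww q (i, j) = n ∧ phi c i j ≠ 0 := by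
    obtain ⟨i, j, h⟩ := exists_phi_ne c hc
    exact ⟨_, i, j, rfl, h⟩
  obtain ⟨ρ, hρ⟩ : ∃ ρ, ρ = Nat.find hex := ⟨_, rfl⟩
  have hlow : ∀ i j, ww q (i, j) < ρ → phi c i j = 0 := by
    intro i j h
    by_contra hne
    exact Nat.find_min hex (hρ ▸ h) ⟨i, j, rfl, hne⟩
  have hred : ∀ i j, ww q (i + (q + 1), j) = ρ → phi c (i + (q + 1)) j = phi c i (j + q) := by
    intro i j h
    rw [phi_rel, hlow i (j + 1), add_zero]
    rw [← h]; simp only [ww]; nlinarith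
  have hIJ : ∃ I J, I ≤ q ∧ ww q (I, J) = ρ ∧ phi c I J ≠ 0 := by
    have : ∀ i j, ww q (i, j) = ρ → phi c i j ≠ 0 →
        ∃ I J, I ≤ q ∧ ww q (I, J) = ρ ∧ phi c I J ≠ 0 := by
      intro i
      induction i using Nat.strong_induction_on with
      | _ i ih =>
        intro j h1 h2
        by_cases hi : i ≤ q
        · exact ⟨i, j, hi, h1, h2⟩
        · obtain ⟨k, rfl⟩ : ∃ k, i = k + (q + 1) := ⟨i - (q + 1), by omega⟩
          rw [hred k j h1] at h2
          refine ih k (by omega) (j + q) ?_ h2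
          rw [← h1]; simp only [ww]; ring
    obtain ⟨i, j, h1, h2⟩ := Nat.find_spec hex
    exact this i j (h1.trans hρ.symm) h2
  obtain ⟨I, J, hI, hw, hne⟩ := hIJ
  have hbig : q * (q + t) + t ≤ q * I + (q + 1) * J + q := by
    by_contra hlt
    exact hne (ho I J hI (by omega))
  have hK : q + t ≤ I + J + 1 := by
    by_contra hlt
    have h1 : I + J + 2 ≤ q + t := by omega
    have h2 : q * (I + J + 2) ≤ q * (q + t) := Nat.mul_le_mul_left _ h1
    have h3 : t + q ≤ J := by nlinarith
    omega
  by_cases hJ : J < q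
  · have hJt : t ≤ J := by
      by_cases h1 : q + t ≤ I + J
      · omega
      · have h1 : I + J + 1 = q + t := by omega
        rw [← h1] at hbig
        nlinarith
    have hcount : (t + 1) * q ≤ (I + 1) * (J + 1) := by
      obtain ⟨x, rfl⟩ := Nat.exists_eq_add_of_le hJt
      obtain ⟨y, rfl⟩ : ∃ y, q = t + x + 1 + y := ⟨q - (t + x + 1), by omega⟩
      have : t + y + 1 ≤ I + 1 := by omega
      calc (t + 1) * (t + x + 1 + y) ≤ (t + y + 1) * (t + x + 1) := by nlinarith
        _ ≤ _ := Nat.mul_le_mul_right _ this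
    refine hcount.trans ?_
    have := card_le_wt c (Finset.range (I + 1) ×ˢ Finset.range (J + 1))
      (fun a => (I - a.1, J - a.2)) ρ ?_ hlow ?_
    · simpa using this
    · intro a ha b hb hab
      simp only [Finset.mem_product, Finset.mem_range] at ha hb
      exact ww_inj (by omega) (by omega) hab
    · intro a ha
      simp only [Finset.mem_product, Finset.mem_range] at ha
      have e1 : a.1 + (I - a.1) = I := by omega
      have e2 : a.2 + (J - a.2) = J := by omega
      refine ⟨?_, ?_⟩
      · rw [← hw]; simp only [ww]
        calc _ = q * (a.1 + (I - a.1)) + (q + 1) * (a.2 + (J - a.2)) := by ring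
          _ = _ := by rw [e1, e2]
      · simp only [e1, e2]; exact hne
  · obtain ⟨x, rfl⟩ : ∃ x, J = x + q := ⟨J - q, by omega⟩
    have hne2 : phi c (I + (q + 1)) x ≠ 0 := by
      rw [hred]; · exact hne
      · rw [← hw]; simp only [ww]; ring
    have hcount : (t + 1) * q ≤ (I + 1) * (x + q + 1) + (q - I) * (x + 1) := by
      obtain ⟨y, rfl⟩ := Nat.exists_eq_add_of_le hI
      have : I + y - I = y := by omega
      rw [this]
      have h1 : (t + 1) ≤ I + x + 2 := by omega
      calc (t + 1) * (I + y) ≤ (I + x + 2) * (I + y) := Nat.mul_le_mul_right _ h1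
        _ ≤ _ := by nlinarith
    refine hcount.trans ?_
    have := card_le_wt c ((Finset.range (I + 1) ×ˢ Finset.range (x + q + 1)) ∪
        (Finset.Ioc I q ×ˢ Finset.range (x + 1)))
      (fun a => if a.1 ≤ I then (I - a.1, x + q - a.2) else (I + (q + 1) - a.1, x - a.2))
      ρ ?_ hlow ?_
    · rw [Finset.card_union_of_disjoint] at this
      · simpa using this
      · rw [Finset.disjoint_left]
        intro a ha hb
        simp only [Finset.mem_product, Finset.mem_range, Finset.mem_Ioc] at ha hb
        omega
    · intro a ha b hb hab
      simp only [Finset.mem_union, Finset.mem_product, Finset.mem_range, Finset.mem_Ioc] at ha hb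
      exact ww_inj (by omega) (by omega) hab
    · intro a ha
      simp only [Finset.mem_union, Finset.mem_product, Finset.mem_range, Finset.mem_Ioc] at ha
      by_cases hle : a.1 ≤ I
      · simp only [hle, if_true]
        have e1 : a.1 + (I - a.1) = I := by omega
        have e2 : a.2 + (x + q - a.2) = x + q := by omega
        refine ⟨?_, ?_⟩
        · rw [← hw]; simp only [ww]
          calc _ = q * (a.1 + (I - a.1)) + (q + 1) * (a.2 + (x + q - a.2)) := by ring
            _ = _ := by rw [e1, e2]
        · simp only [e1, e2]; exact hne
      · simp only [hle, if_false]
        have e1 : a.1 + (I + (q + 1) - a.1) = I + (q + 1) := by omega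
        have e2 : a.2 + (x - a.2) = x := by omega
        refine ⟨?_, ?_⟩
        · rw [← hw]; simp only [ww]
          calc _ = q * (a.1 + (I + (q + 1) - a.1)) + (q + 1) * (a.2 + (x - a.2)) := by ring
            _ = _ := by rw [e1, e2]; ring
        · simp only [e1, e2]; exact hne2

/-- `q`-th powers are additive. -/
lemma frob_add {q : ℕ} (hpp : IsPrimePow q) {F : Type} [Field F] [Fintype F]
    (hF : Fintype.card F = q ^ 2) : ∃ p k : ℕ, p.Prime ∧ CharP F p ∧ q = p ^ k := by
  obtain ⟨p, k, hp, hk, rfl⟩ := hpp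
  obtain ⟨p', hc⟩ := CharP.exists F
  have := hc
  obtain ⟨n, hp', hn⟩ := FiniteField.card F p'
  have h1 : p' ∣ p := by
    have : p' ∣ (p ^ k) ^ 2 := by
      rw [← hF, hn]; exact dvd_pow_self _ n.pos.ne'
    exact hp'.dvd_of_dvd_pow (hp'.dvd_of_dvd_pow this)
  have h2 : p' = p := (Nat.prime_dvd_prime_iff_eq hp' hp.nat_prime).1 h1
  subst h2
  exact ⟨p', k, hp', hc, rfl⟩

lemma card_trace {q : ℕ} (hq : 2 ≤ q) (hpp : IsPrimePow q) {F : Type} [Field F] [Fintype F]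
    [DecidableEq F]
    (hF : Fintype.card F = q ^ 2) (t : F) (ht : t ^ q = t) :
    q ≤ (Finset.univ.filter (fun z : F => z ^ q + z = t)).card := by
  classical
  obtain ⟨p, k, hp, hc, hqp⟩ := frob_add hpp hF
  have := hc
  have : Fact p.Prime := ⟨hp⟩
  have : ExpChar (Polynomial F) p := inferInstance
  let h : Polynomial F := Polynomial.X ^ q + Polynomial.X - Polynomial.C t
  have hmul : h * (h ^ (q - 1) - 1) = Polynomial.X ^ (Fintype.card F) - Polynomial.X := by
    have e : h * h ^ (q - 1) = h ^ q := by rw [← pow_succ']; congr 1; omega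
    have e2 : h ^ q = Polynomial.X ^ (q ^ 2) + Polynomial.X ^ q - Polynomial.C t := by
      have h3 : h ^ p ^ k = (Polynomial.X ^ q) ^ p ^ k + Polynomial.X ^ p ^ k
          - (Polynomial.C t) ^ p ^ k := by
        simp only [h]
        rw [sub_pow_expChar_pow, add_pow_expChar_pow]
      rw [← hqp] at h3
      rw [h3, ← Polynomial.C_pow, ht, ← pow_mul, sq]
    rw [mul_sub, e, e2, hF]; simp only [h]; ring
  have hdeg : h.natDegree = q := by
    simp only [h]
    rw [add_sub_assoc]
    rw [Polynomial.natDegree_add_eq_left_of_natDegree_lt]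
    · simp
    · rw [Polynomial.natDegree_X_sub_C, Polynomial.natDegree_X_pow]; omega
  have hX0 : (Polynomial.X ^ (Fintype.card F) - Polynomial.X : Polynomial F) ≠ 0 :=
    FiniteField.X_pow_card_sub_X_ne_zero F Fintype.one_lt_card
  have hroots := FiniteField.roots_X_pow_card_sub_X F
  rw [← hmul] at hroots hX0
  rw [Polynomial.roots_mul hX0] at hroots
  have hcard := congrArg Multiset.card hroots
  rw [Multiset.card_add, Finset.card_val, Finset.card_univ, hF] at hcard
  have hk : Multiset.card (h ^ (q - 1) - 1).roots ≤ (q - 1) * q := by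
    refine (Polynomial.card_roots' _).trans ?_
    refine (Polynomial.natDegree_sub_le _ _).trans ?_
    rw [Polynomial.natDegree_pow, hdeg]; simp
  have hnd : h.roots.Nodup := by
    refine Multiset.nodup_of_le (t := Finset.univ.val) ?_ Finset.univ.nodup
    rw [← hroots]; exact Multiset.le_add_right _ _
  have hq2 : q ≤ Multiset.card h.roots := by
    obtain ⟨r, rfl⟩ : ∃ r, q = r + 1 := ⟨q - 1, by omega⟩
    simp only [Nat.add_sub_cancel] at hk hcard
    nlinarith
  rw [← Multiset.toFinset_card_of_nodup hnd] at hq2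
  refine hq2.trans (Finset.card_le_card ?_)
  intro z hz
  simp only [Multiset.mem_toFinset] at hz
  have := (Polynomial.mem_roots'.1 hz).2
  simp only [h, Polynomial.IsRoot, Polynomial.eval_sub, Polynomial.eval_add,
    Polynomial.eval_pow, Polynomial.eval_X, Polynomial.eval_C] at this
  simpa using sub_eq_zero.1 this

lemma exists_dual {F : Type} [Field F] (A : Finset F) (n : ℕ) (hn : n < A.card) :
    ∃ x : F → F, (∃ a ∈ A, x a ≠ 0) ∧ ∀ i < n, ∑ a ∈ A, x a * a ^ i = 0 := by
  classical
  let T : (A → F) →ₗ[F] (Fin n → F) :=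
    { toFun := fun x i => ∑ a : A, x a * (a : F) ^ (i : ℕ)
      map_add' := by
        intro x y; funext i; simp [add_mul, Finset.sum_add_distrib]
      map_smul' := by
        intro r x; funext i; simp [Finset.mul_sum, mul_assoc] }
  have hker := LinearMap.ker_ne_bot_of_finrank_lt (f := T) (by simpa using hn)
  obtain ⟨x, hx, hx0⟩ := (Submodule.ne_bot_iff _).1 hker
  obtain ⟨a, ha⟩ := Function.ne_iff.1 hx0
  refine ⟨fun b => if h : b ∈ A then x ⟨b, h⟩ else 0, ⟨a, a.2, by simpa using ha⟩, ?_⟩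
  intro i hi
  have := congrFun (LinearMap.mem_ker.1 hx) ⟨i, hi⟩
  simp only [T, LinearMap.coe_mk, AddHom.coe_mk, Pi.zero_apply] at this
  rw [← Finset.sum_coe_sort, ← this]
  refine Finset.sum_congr rfl fun b _ => ?_
  simp

/-- The word of small weight (after normalisation). -/
lemma upper {q : ℕ} (hq : 2 ≤ q) (hpp : IsPrimePow q) {F : Type} [Field F] [Fintype F]
    (hF : Fintype.card F = q ^ 2) (t : ℕ) (ht : t + 2 < q) :
    ∃ c : ↥(Dset q F) → F, c ≠ 0 ∧ wt c ≤ (t + 1) * q ∧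
      (∀ i j : ℕ, q * i + (q + 1) * j + q < q * (q + t) + t → phi c i j = 0) ∧
      ∑ P, c P * ((P : F × F).1 ^ q * ((P : F × F).2)⁻¹) = 0 := by
  classical
  obtain ⟨p, k, hp, hcp, hqp⟩ := frob_add hpp hF
  have := hcp
  have : Fact p.Prime := ⟨hp⟩
  have hsub : ∀ x y : F, (x - y) ^ q = x ^ q - y ^ q := by
    intro x y; rw [hqp]; exact sub_pow_expChar_pow x y k (p := p)
  have hq0 : q ≠ 0 := by omega
  -- the set U
  obtain ⟨Z, hZsub, hZcard⟩ := Finset.exists_subset_card_eq (card_trace hq hpp hF 1 (one_pow q))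
  have hZ : ∀ z ∈ Z, z ^ q + z = 1 := fun z hz => by simpa using hZsub hz
  obtain ⟨U, hUdef⟩ : ∃ U : Finset F, U = Z.image (fun z => z⁻¹) := ⟨_, rfl⟩
  have hUcard : U.card = q := by
    rw [hUdef, Finset.card_image_of_injective _ inv_injective, hZcard]
  have hU0 : ∀ u ∈ U, u ≠ 0 := by
    intro u hu
    rw [hUdef] at hu
    obtain ⟨z, hz, rfl⟩ := Finset.mem_image.1 hu
    have := hZ z hz
    intro h0
    rw [inv_eq_zero] at h0
    rw [h0, zero_pow hq0] at this
    simp at this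
  have hU : ∀ u ∈ U, u ^ q + u = u ^ (q + 1) := by
    intro u hu
    have h0 := hU0 u hu
    rw [hUdef] at hu
    obtain ⟨z, hz, rfl⟩ := Finset.mem_image.1 hu
    have h1 := hZ z hz
    have hz0 : z ≠ 0 := by simpa using h0
    rw [inv_pow, inv_pow, pow_succ]
    field_simp
    linear_combination h1
  -- the set B
  have hBc : t + 1 ≤ ((Finset.univ.filter (fun z : F => z ^ q + z = 0)).erase 0).card := by
    have h1 := card_trace hq hpp hF 0 (zero_pow hq0)
    have h2 := Finset.pred_card_le_card_erase
      (s := Finset.univ.filter (fun z : F => z ^ q + z = 0)) (a := 0)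
    omega
  obtain ⟨B, hBsub, hBcard⟩ := Finset.exists_subset_card_eq hBc
  have hB0 : ∀ b ∈ B, b ≠ 0 := fun b hb => (Finset.mem_erase.1 (hBsub hb)).1
  have hB : ∀ b ∈ B, b ^ q + b = 0 := fun b hb => by
    simpa using (Finset.mem_erase.1 (hBsub hb)).2
  obtain ⟨x, ⟨u0, hu0, hxu0⟩, hx⟩ := exists_dual U (q - 1) (by omega)
  obtain ⟨y, ⟨b0, hb0, hyb0⟩, hy⟩ := exists_dual B t (by omega)
  have hmem : ∀ u ∈ U, ∀ b ∈ B, (u, u - b) ∈ Dset q F := by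
    intro u hu b hb
    refine ⟨?_, ?_⟩
    · simp only [hsub]
      linear_combination hU u hu - hB b hb
    · intro h
      exact hU0 u hu (congrArg Prod.fst h)
  let c : ↥(Dset q F) → F := fun P =>
    if (P : F × F).1 ∈ U ∧ (P : F × F).1 - (P : F × F).2 ∈ B then
      x (P : F × F).1 * y ((P : F × F).1 - (P : F × F).2) else 0
  have hsum : ∀ f : F → F → F, ∑ P, c P * f (P : F × F).1 (P : F × F).2 =
      ∑ u ∈ U, ∑ b ∈ B, x u * y b * f u (u - b) := by
    intro f
    rw [← Finset.sum_product']
    symm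
    refine Finset.sum_of_injOn (fun a => if h : (a.1, a.1 - a.2) ∈ Dset q F then
      (⟨(a.1, a.1 - a.2), h⟩ : ↥(Dset q F)) else ⟨(u0, u0 - b0), hmem u0 hu0 b0 hb0⟩) ?_ ?_ ?_ ?_
    · rintro ⟨u, b⟩ h1 ⟨u', b'⟩ h2 h
      simp only [Finset.coe_product, Set.mem_prod, Finset.mem_coe] at h1 h2
      simp only [hmem u h1.1 b h1.2, hmem u' h2.1 b' h2.2, dif_pos, Subtype.mk.injEq,
        Prod.mk.injEq] at h
      obtain ⟨rfl, h⟩ := h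
      simpa using h
    · intro a _; simp
    · intro P _ hP
      have : c P = 0 := by
        simp only [c]
        rw [if_neg]
        rintro ⟨h1, h2⟩
        apply hP
        refine ⟨((P : F × F).1, (P : F × F).1 - (P : F × F).2), by simp [h1, h2], ?_⟩
        have h3 := hmem _ h1 _ h2
        simp only [h3, dif_pos]
        apply Subtype.ext
        simp
      rw [this, zero_mul]
    · rintro ⟨u, b⟩ h1
      simp only [Finset.mem_product] at h1
      simp [hmem u h1.1 b h1.2, c, h1.1, h1.2]
  refine ⟨c, ?_, ?_, ?_, ?_⟩
  · intro h
    have := congrFun h ⟨(u0, u0 - b0), hmem u0 hu0 b0 hb0⟩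
    simp [c, hu0, hb0, hxu0, hyb0] at this
  · have : Nat.card {P // c P ≠ 0} ≤ Nat.card (U ×ˢ B : Finset (F × F)) := by
      refine Nat.card_le_card_of_injective
        (fun P => (⟨((P.1 : F × F).1, (P.1 : F × F).1 - (P.1 : F × F).2), ?_⟩ :
          (U ×ˢ B : Finset (F × F)))) ?_
      · have := P.2
        simp only [c, ne_eq, ite_eq_right_iff, not_forall] at this
        obtain ⟨h, _⟩ := this
        simpa using h
      · rintro ⟨P, hP⟩ ⟨Q, hQ⟩ h
        simp only [Subtype.mk.injEq, Prod.mk.injEq] at h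
        obtain ⟨h1, h2⟩ := h
        rw [h1] at h2
        exact Subtype.ext (Subtype.ext (Prod.ext h1 (by simpa using h2)))
    rw [wt]
    refine this.trans (le_of_eq ?_)
    rw [Nat.card_eq_fintype_card, Fintype.card_coe, Finset.card_product, hUcard, hBcard, mul_comm]
  · intro i j hij
    rw [phi, hsum (fun u v => u ^ i * v ^ j)]
    have hterm : ∀ r ∈ Finset.range (j + 1),
        ∑ u ∈ U, ∑ b ∈ B, x u * y b * (u ^ i * (u ^ r * (-b) ^ (j - r) * (j.choose r : F))) = 0 := by
      intro r hr
      have hr : r ≤ j := by simpa [Nat.lt_succ_iff] using hr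
      have e : ∑ u ∈ U, ∑ b ∈ B, x u * y b * (u ^ i * (u ^ r * (-b) ^ (j - r) * (j.choose r : F)))
          = (∑ u ∈ U, x u * u ^ (i + r)) * (∑ b ∈ B, y b * b ^ (j - r)) *
            ((-1) ^ (j - r) * (j.choose r : F)) := by
        rw [Finset.sum_mul_sum, Finset.sum_mul]
        refine Finset.sum_congr rfl fun u _ => ?_
        rw [Finset.sum_mul]
        refine Finset.sum_congr rfl fun b _ => ?_
        rw [neg_pow b, pow_add]; ring
      rw [e]
      by_cases h1 : i + r < q - 1
      · rw [hx _ h1]; simp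
      · by_cases h2 : j - r < t
        · rw [hy _ h2]; simp
        · exfalso
          have h3 : q + t ≤ i + j + 1 := by omega
          have h4 : t ≤ j := by omega
          have h5 := Nat.mul_le_mul_left q h3
          nlinarith
    calc _ = ∑ u ∈ U, ∑ b ∈ B, ∑ r ∈ Finset.range (j + 1),
          x u * y b * (u ^ i * (u ^ r * (-b) ^ (j - r) * (j.choose r : F))) := by
          refine Finset.sum_congr rfl fun u _ => Finset.sum_congr rfl fun b _ => ?_
          rw [sub_eq_add_neg, add_pow, Finset.mul_sum, Finset.mul_sum]
      _ = ∑ r ∈ Finset.range (j + 1), ∑ u ∈ U, ∑ b ∈ B,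
          x u * y b * (u ^ i * (u ^ r * (-b) ^ (j - r) * (j.choose r : F))) := by
          rw [Finset.sum_comm]
          rw [Finset.sum_congr rfl fun b _ => Finset.sum_comm]
          rw [Finset.sum_comm]
          exact Finset.sum_congr rfl fun r _ => Finset.sum_comm
      _ = 0 := Finset.sum_eq_zero hterm
  · rw [hsum (fun u v => u ^ q * v⁻¹)]
    obtain ⟨n, rfl⟩ : ∃ n, q = n + 1 := ⟨q - 1, by omega⟩
    have hgeo : ∀ u ∈ U, ∀ b ∈ B, u ^ (n + 1) * (u - b)⁻¹ =
        ∑ i ∈ Finset.range n, u ^ i * b ^ (n - 1 - i) := by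
      intro u hu b hb
      have hu1 := hU u hu
      have hb1 := hB b hb
      have hne : u - b ≠ 0 := by
        intro h
        have : u = b := sub_eq_zero.1 h
        subst this
        rw [hb1] at hu1
        exact hU0 u hu (pow_eq_zero_iff (by omega) |>.1 hu1.symm)
      rw [← div_eq_mul_inv, div_eq_iff hne, (Commute.all u b).geom_sum₂_mul n]
      have h2 : u ^ n + 1 = u ^ (n + 1) := by
        apply mul_right_cancel₀ (hU0 u hu)
        linear_combination hu1
      have h3 : b ^ n = -1 := by
        apply mul_right_cancel₀ (hB0 b hb)
        linear_combination hb1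
      rw [h3, ← h2]; ring
    rw [Finset.sum_congr rfl fun u hu => Finset.sum_congr rfl fun b hb => by rw [hgeo u hu b hb]]
    rw [Finset.sum_comm]
    refine Finset.sum_eq_zero fun b _ => ?_
    simp only [Finset.mul_sum]
    rw [Finset.sum_comm]
    refine Finset.sum_eq_zero fun i hi => ?_
    have := hx i (by simpa using hi)
    calc _ = ∑ u ∈ U, (y b * b ^ (n - 1 - i)) * (x u * u ^ i) :=
          Finset.sum_congr rfl fun u _ => by ring
      _ = 0 := by rw [← Finset.mul_sum, this, mul_zero]

lemma snd_ne {q : ℕ} {F : Type} [Field F] (hq : 2 ≤ q) (P : ↥(Dset q F)) :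
    (P : F × F).2 ≠ 0 := by
  intro h
  have h1 := P.2.1
  rw [h, zero_pow (by omega), add_zero] at h1
  exact P.2.2 (Prod.ext (pow_eq_zero_iff (by omega) |>.1 h1.symm) h)

lemma mem_dual {q : ℕ} {F : Type} [Field F] [Fintype F] (m n : ℤ) (c : ↥(Dset q F) → F) :
    c ∈ dualCode q F m n ↔ ∀ ij ∈ S q m n, ∑ P, c P * evalVec q F ij P = 0 := by
  constructor
  · intro h ij hij
    exact h _ (Submodule.subset_span ⟨ij, hij, rfl⟩)
  · intro h w hw
    induction hw using Submodule.span_induction with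
    | mem w hw => obtain ⟨ij, hij, rfl⟩ := hw; exact h ij hij
    | zero => simp
    | add v w _ _ h1 h2 => simp [mul_add, Finset.sum_add_distrib, h1, h2]
    | smul r w _ h1 =>
      calc _ = ∑ P, r * (c P * w P) := Finset.sum_congr rfl fun P _ => by
            simp only [Pi.smul_apply, smul_eq_mul]; ring
        _ = 0 := by rw [← Finset.mul_sum, h1, mul_zero]

/-- Theorem 3.3, case 4: if `a₀ + b₀ < a₁ = q` and `b₁ = q`, then
`d(C(K + a P∞ + b P₀)^⊥) = d* + q - (a₀ + b₀) = (a₀ + b₀ - 1) q`,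
where `K = (q-2)(q+1) P∞`. -/
theorem minDist_case4 (q : ℕ) (hq : 2 ≤ q) (hpp : IsPrimePow q)
    (F : Type) [Field F] [Fintype F] (hF : Fintype.card F = q ^ 2)
    (a₀ b₀ a₁ b₁ a b : ℤ)
    (ha₁ : a₁ = (q : ℤ)) (hb₁ : b₁ = (q : ℤ)) (hcase : a₀ + b₀ < (q : ℤ))
    (ha : a = a₀ * ((q : ℤ) + 1) - a₁) (hb : b = b₀ * ((q : ℤ) + 1) - b₁)
    (hdeg : 0 ≤ a + b ∧ a + b ≤ (q : ℤ) ^ 3 - 1)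
    (hrange : (q : ℤ) < a + b ∨ (a + b ≤ (q : ℤ) ∧ a₁ ≠ 0 ∧ b₁ ≠ 0)) :
    (minDist q F (((q : ℤ) - 2) * ((q : ℤ) + 1) + a) b : ℤ) = a + b + (q : ℤ) - (a₀ + b₀) ∧
      (minDist q F (((q : ℤ) - 2) * ((q : ℤ) + 1) + a) b : ℤ) = (a₀ + b₀ - 1) * (q : ℤ) := by
  subst ha₁ hb₁
  obtain ⟨hd1, hd2⟩ := hdeg
  have hq' : (2 : ℤ) ≤ q := by exact_mod_cast hq
  have hab : a + b = (a₀ + b₀) * ((q : ℤ) + 1) - 2 * q := by rw [ha, hb]; ring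
  have hs2 : 2 ≤ a₀ + b₀ := by
    by_contra h
    have : a₀ + b₀ ≤ 1 := by omega
    nlinarith
  obtain ⟨t, ht⟩ : ∃ t : ℕ, a₀ + b₀ = t + 2 := ⟨(a₀ + b₀ - 2).toNat, by omega⟩
  have htq : t + 2 < q := by omega
  suffices hmain : minDist q F (((q : ℤ) - 2) * ((q : ℤ) + 1) + a) b = (t + 1) * q by
    rw [hmain, hab, ht]
    push_cast
    constructor <;> ring
  have ha0 : a₀ = t + 2 - b₀ := by omega
  subst ha0
  have hb' : b = (b₀ - 1) * ((q : ℤ) + 1) + 1 := by rw [hb]; ring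
  obtain ⟨c, hc0, hcw, hc1, hc2⟩ := upper hq hpp hF t htq
  have hlower : ∀ c ∈ dualCode q F (((q : ℤ) - 2) * ((q : ℤ) + 1) + a) b, c ≠ 0 →
      (t + 1) * q ≤ wt c := by
    intro d hd hd0
    rw [mem_dual] at hd
    let e : ↥(Dset q F) → F := fun P => d P * (P : F × F).2 ^ (-(b₀ - 1))
    have hwt : wt e = wt d := by
      unfold wt
      refine Nat.card_congr (Equiv.subtypeEquivRight fun P => ?_)
      simp [e, zpow_ne_zero _ (snd_ne hq P)]
    rw [← hwt]
    refine lower t htq e ?_ ?_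
    · intro h
      apply hd0
      funext P
      have := congrFun h P
      simpa [e, zpow_ne_zero _ (snd_ne hq P)] using this
    · intro i j hi hij
      have hij' : (q : ℤ) * i + (q + 1) * j + q < q * (q + t) + t := by exact_mod_cast hij
      rw [← hd (i, j - (b₀ - 1)) ?_]
      · refine Finset.sum_congr rfl fun P _ => ?_
        simp only [e, evalVec]
        rw [sub_eq_add_neg (j : ℤ), zpow_add₀ (snd_ne hq P), zpow_natCast, zpow_natCast]
        ring
      · refine ⟨by simp, by simpa using hi, ?_, ?_⟩
        · simp only [ha]; nlinarith
        · simp only [hb']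
          have : (0 : ℤ) ≤ ((q : ℤ) + 1) * j := by positivity
          have : (0 : ℤ) ≤ i := by positivity
          nlinarith
  obtain ⟨d, hdd⟩ : ∃ d : ↥(Dset q F) → F, d = fun P => c P * (P : F × F).2 ^ (b₀ - 1) := ⟨_, rfl⟩
  have hd0 : d ≠ 0 := by
    intro h
    apply hc0
    funext P
    have := congrFun h P
    simpa [hdd, zpow_ne_zero _ (snd_ne hq P)] using this
  have hwt : wt d = wt c := by
    unfold wt
    refine Nat.card_congr (Equiv.subtypeEquivRight fun P => ?_)
    simp [hdd, zpow_ne_zero _ (snd_ne hq P)]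
  have hd : d ∈ dualCode q F (((q : ℤ) - 2) * ((q : ℤ) + 1) + a) b := by
    rw [mem_dual]
    rintro ⟨i, j⟩ ⟨h1, h2, h3, h4⟩
    simp only at h1 h2 h3 h4
    obtain ⟨i, rfl⟩ := Int.eq_ofNat_of_zero_le h1
    obtain ⟨j', hj'⟩ : ∃ j', j' = j + (b₀ - 1) := ⟨_, rfl⟩
    have hj : j = j' - (b₀ - 1) := by omega
    subst hj
    have h5 : -1 ≤ (i : ℤ) + ((q : ℤ) + 1) * j' := by rw [hb'] at h4; nlinarith
    have h6 : (q : ℤ) * i + (q + 1) * j' + q < q * (q + t) + t := by rw [ha] at h3; nlinarith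
    have hs : ∑ P, d P * evalVec q F ((i : ℤ), j' - (b₀ - 1)) P =
        ∑ P, c P * ((P : F × F).1 ^ i * (P : F × F).2 ^ j') := by
      refine Finset.sum_congr rfl fun P _ => ?_
      simp only [hdd, evalVec]
      have hz := zpow_add₀ (snd_ne hq P) (j' - (b₀ - 1)) (b₀ - 1)
      rw [sub_add_cancel] at hz
      rw [hz, zpow_natCast]
      ring
    rw [hs]
    by_cases hj0 : 0 ≤ j'
    · obtain ⟨j, rfl⟩ := Int.eq_ofNat_of_zero_le hj0
      have := hc1 i j (by exact_mod_cast h6)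
      simpa [phi] using this
    · have hj1 : j' = -1 := by
        by_contra hne
        have : j' ≤ -2 := by omega
        nlinarith
      subst hj1
      have : i = q := by omega
      subst this
      simpa using hc2
  have hmem : wt d ∈ {w | ∃ c ∈ dualCode q F (((q : ℤ) - 2) * ((q : ℤ) + 1) + a) b,
      c ≠ 0 ∧ wt c = w} := ⟨d, hd, hd0, rfl⟩
  apply le_antisymm
  · exact (Nat.sInf_le hmem).trans (hwt ▸ hcw)
  · obtain ⟨c', h1, h2, h3⟩ := Nat.sInf_mem ⟨_, hmem⟩
    have := hlower c' h1 h2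
    rw [h3] at this
    exact this

end HermitianTwoPoint
end

section
/- Let a₀, b₀, a₁, b₁ be integers with a₀ ≥ 0, b₀ ≥ 0, 0 ≤ a₁ ≤ q and 0 ≤ b₁ ≤ q, and set a = a₀(q+1) + a₁ and b = b₀(q+1) + b₁. Assume either a + b < (q−2)(q+1), or ((q−2)(q+1) ≤ a + b ≤ (q−2)(q+1) + q and (a₁ = 0 or b₁ = 0)). Then d(C(a, b)^⊥) = a₀ + b₀ + 2. (Theorem 3.5: the divisor G = aP∞ + bP₀ has degree below deg K, or degree between deg K and deg K + q and is linearly equivalent to a one-point divisor, the latter condition being equivalent to (q+1) | a or (q+1) | b.) -/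
open scoped BigOperators

namespace HermitianTwoPoint

section Helpers

variable {q : ℕ} {F : Type} [Field F]

lemma snd_ne_zero (hq : 2 ≤ q) (P : ↥(Dset q F)) : (P : F × F).2 ≠ 0 := by
  obtain ⟨⟨u, v⟩, h1, h2⟩ := P
  intro h
  simp only at h h1
  subst h
  rw [zero_pow (by omega), add_zero] at h1
  have : u = 0 := by
    by_contra hu
    exact pow_ne_zero (q + 1) hu h1.symm
  subst this
  exact h2 rfl

/-- Evaluations of polynomials of total degree at most `k`. -/
def W (q : ℕ) (F : Type) [Field F] (k : ℕ) : Submodule F (↥(Dset q F) → F) :=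
  Submodule.span F {f | ∃ i j : ℕ, i + j ≤ k ∧
    f = fun P : ↥(Dset q F) => (P : F × F).1 ^ i * (P : F × F).2 ^ j}

lemma W_mul (k : ℕ) (α β γ : F) (f : ↥(Dset q F) → F) (hf : f ∈ W q F k) :
    (fun P : ↥(Dset q F) => (α * (P : F × F).1 + β * (P : F × F).2 + γ) * f P)
      ∈ W q F (k + 1) := by
  unfold W at hf
  induction hf using Submodule.span_induction with
  | mem x hx =>
    obtain ⟨i, j, hij, rfl⟩ := hx
    have h1 : (fun P : ↥(Dset q F) => (P : F × F).1 ^ (i+1) * (P : F × F).2 ^ j) ∈ W q F (k + 1) :=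
      Submodule.subset_span ⟨i+1, j, by omega, rfl⟩
    have h2 : (fun P : ↥(Dset q F) => (P : F × F).1 ^ i * (P : F × F).2 ^ (j+1)) ∈ W q F (k + 1) :=
      Submodule.subset_span ⟨i, j+1, by omega, rfl⟩
    have h3 : (fun P : ↥(Dset q F) => (P : F × F).1 ^ i * (P : F × F).2 ^ j) ∈ W q F (k + 1) :=
      Submodule.subset_span ⟨i, j, by omega, rfl⟩
    have := add_mem (add_mem (Submodule.smul_mem _ α h1) (Submodule.smul_mem _ β h2))
      (Submodule.smul_mem _ γ h3)
    convert this using 1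
    funext P
    simp only [Pi.add_apply, Pi.smul_apply, smul_eq_mul]
    ring
  | zero =>
    convert Submodule.zero_mem (W q F (k+1)) using 1
    funext P
    simp
  | add x y _ _ hx hy =>
    convert add_mem hx hy using 1
    funext P
    simp only [Pi.add_apply]
    ring
  | smul t x _ hx =>
    convert Submodule.smul_mem _ t hx using 1
    funext P
    simp only [Pi.smul_apply, smul_eq_mul]
    ring

lemma exists_sep (P : ↥(Dset q F)) (T : Finset ↥(Dset q F)) (hP : P ∉ T) :
    ∃ f ∈ W q F T.card, f P ≠ 0 ∧ ∀ Q ∈ T, f Q = 0 := by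
  classical
  induction T using Finset.induction_on with
  | empty =>
    refine ⟨fun _ => 1, Submodule.subset_span ⟨0, 0, by simp, by simp⟩, by simp, by simp⟩
  | insert Q T hQ ih =>
    obtain ⟨f, hf, hfP, hfT⟩ := ih (fun h => hP (Finset.mem_insert_of_mem h))
    have hne : P ≠ Q := fun h => hP (h ▸ Finset.mem_insert_self _ _)
    rw [Finset.card_insert_of_notMem hQ]
    by_cases h : (P : F × F).1 = (Q : F × F).1
    · have h2 : (P : F × F).2 ≠ (Q : F × F).2 := fun h' => hne (Subtype.ext (Prod.ext h h'))
      refine ⟨_, W_mul _ 0 1 (-(Q : F × F).2) f hf, ?_, ?_⟩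
      · apply mul_ne_zero _ hfP
        intro h3
        apply h2
        linear_combination h3
      · intro R hR
        rcases Finset.mem_insert.1 hR with rfl | hR
        · simp
        · simp [hfT R hR]
    · refine ⟨_, W_mul _ 1 0 (-(Q : F × F).1) f hf, ?_, ?_⟩
      · apply mul_ne_zero _ hfP
        intro h3
        apply h
        linear_combination h3
      · intro R hR
        rcases Finset.mem_insert.1 hR with rfl | hR
        · simp
        · simp [hfT R hR]

lemma W_shift (hq : 2 ≤ q) (k b₀ : ℕ) (a b : ℤ) (hk : k ≤ q)
    (ha : ((k : ℤ) - b₀) * ((q : ℤ) + 1) ≤ a) (hb : (b₀ : ℤ) * ((q : ℤ) + 1) ≤ b)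
    (f : ↥(Dset q F) → F) (hf : f ∈ W q F k) :
    (fun P : ↥(Dset q F) => (P : F × F).2 ^ (-(b₀ : ℤ)) * f P) ∈ Code q F a b := by
  unfold W at hf
  induction hf using Submodule.span_induction with
  | mem x hx =>
    obtain ⟨i, j, hij, rfl⟩ := hx
    apply Submodule.subset_span
    refine ⟨((i : ℤ), (j : ℤ) - b₀), ⟨by simp, ?_, ?_, ?_⟩, ?_⟩
    · simp only; omega
    · simp only
      have : ((i : ℤ) + j) ≤ k := by exact_mod_cast hij
      nlinarith
    · simp only
      nlinarith
    · funext P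
      simp only [evalVec]
      rw [sub_eq_add_neg, zpow_add₀ (snd_ne_zero hq P), zpow_natCast, zpow_natCast]
      ring
  | zero =>
    convert Submodule.zero_mem (Code q F a b) using 1
    funext P
    simp
  | add x y _ _ hx hy =>
    convert add_mem hx hy using 1
    funext P
    simp only [Pi.add_apply]
    ring
  | smul t x _ hx =>
    convert Submodule.smul_mem _ t hx using 1
    funext P
    simp only [Pi.smul_apply, smul_eq_mul]
    ring

lemma lower_s5 [Fintype F] (hq : 2 ≤ q) (a₀ b₀ : ℕ) (a b : ℤ) (hk : a₀ + b₀ ≤ q)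
    (ha : (a₀ : ℤ) * ((q : ℤ) + 1) ≤ a) (hb : (b₀ : ℤ) * ((q : ℤ) + 1) ≤ b)
    (c : ↥(Dset q F) → F) (hc : c ∈ dualCode q F a b) (h0 : c ≠ 0) :
    a₀ + b₀ + 2 ≤ wt c := by
  classical
  by_contra hlt
  obtain ⟨P, hP⟩ := Function.ne_iff.1 h0
  simp only [Pi.zero_apply] at hP
  have hwt : wt c = (Finset.univ.filter (fun P => c P ≠ 0)).card := by
    unfold wt
    rw [Nat.card_eq_fintype_card, Fintype.card_subtype]
  set T := (Finset.univ.filter (fun P => c P ≠ 0)).erase P with hT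
  have hTc : T.card + 1 = wt c := by
    rw [hwt, hT]
    exact Finset.card_erase_add_one (by simp [hP])
  obtain ⟨f, hf, hfP, hfT⟩ := exists_sep P T (by simp [hT])
  have hTk : T.card ≤ a₀ + b₀ := by omega
  have hw := hc _ (W_shift hq T.card b₀ a b (by omega) (by
    have : (T.card : ℤ) ≤ a₀ + b₀ := by exact_mod_cast hTk
    nlinarith) hb f hf)
  rw [Finset.sum_eq_single P] at hw
  · exact mul_ne_zero hP (mul_ne_zero (zpow_ne_zero _ (snd_ne_zero hq P)) hfP) hw
  · intro Q _ hQ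
    by_cases hcQ : c Q = 0
    · simp [hcQ]
    · rw [hfT Q (by simp [hT, hQ, hcQ])]
      simp
  · simp

lemma upper_s5 [Fintype F] (a₀ b₀ : ℕ) (a b : ℤ) (V : Finset F) (g : F → F)
    (hV : ∀ v ∈ V, (g v, v) ∈ Dset q F) (hcard : a₀ + b₀ + 2 ≤ V.card)
    (hS : ∀ ij ∈ S q a b, ∃ α : F, ∃ l : ℤ, (-(b₀ : ℤ) ≤ l ∧ l ≤ a₀ ∨ α = 0) ∧
      ∀ v ∈ V, (g v) ^ ij.1 * v ^ ij.2 = α * v ^ l) :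
    ∃ c ∈ dualCode q F a b, c ≠ 0 ∧ wt c ≤ a₀ + b₀ + 2 := by
  classical
  obtain ⟨V', hV', hc'⟩ := Finset.exists_subset_card_eq hcard
  let e : V' → ↥(Dset q F) := fun v => ⟨(g v, v), hV v (hV' v.2)⟩
  have he : Function.Injective e := by
    intro v w h
    have := congrArg (fun P : ↥(Dset q F) => (P : F × F).2) h
    exact Subtype.ext this
  let L : (V' → F) →ₗ[F] ((Finset.Icc (-(b₀ : ℤ)) a₀) → F) :=
    { toFun := fun x l => ∑ v, x v * (v : F) ^ (l : ℤ)
      map_add' := by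
        intro x y; funext l
        simp [add_mul, Finset.sum_add_distrib]
      map_smul' := by
        intro t x; funext l
        simp [Finset.mul_sum, mul_assoc] }
  have hker : LinearMap.ker L ≠ ⊥ := by
    apply LinearMap.ker_ne_bot_of_finrank_lt
    rw [Module.finrank_fintype_fun_eq_card, Module.finrank_fintype_fun_eq_card]
    simp only [Fintype.card_coe, hc', Int.card_Icc]
    omega
  obtain ⟨x, hx, hx0⟩ := Submodule.exists_mem_ne_zero_of_ne_bot hker
  refine ⟨Function.extend e x 0, ?_, ?_, ?_⟩
  · intro w hw
    unfold Code at hw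
    have key : ∀ w : ↥(Dset q F) → F, ∑ P, Function.extend e x 0 P * w P
        = ∑ v, x v * w (e v) := by
      intro w
      symm
      apply Fintype.sum_of_injective e he
      · intro P hP
        rw [Function.extend_apply' _ _ _ (by simpa using hP)]
        simp
      · intro v
        rw [he.extend_apply]
    induction hw using Submodule.span_induction with
    | mem w hw =>
      obtain ⟨ij, hij, rfl⟩ := hw
      obtain ⟨α, l, hl, h⟩ := hS ij hij
      rw [key]
      have h1 : ∀ v : V', x v * evalVec q F ij (e v) = α * (x v * (v : F) ^ l) := by
        intro v
        have := h v (hV' v.2)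
        simp only [evalVec, e]
        rw [this]; ring
      rw [Finset.sum_congr rfl (fun v _ => h1 v), ← Finset.mul_sum]
      rcases hl with hl | hl
      · have := congrFun (LinearMap.mem_ker.1 hx) ⟨l, Finset.mem_Icc.2 hl⟩
        have h2 : ∑ v, x v * (v : F) ^ l = 0 := this
        rw [h2, mul_zero]
      · rw [hl, zero_mul]
    | zero => simp
    | add y z _ _ hy hz =>
      simp only [Pi.add_apply, mul_add, Finset.sum_add_distrib, hy, hz, add_zero]
    | smul t y _ hy =>
      have : ∀ P, Function.extend e x 0 P * (t • y) P = t * (Function.extend e x 0 P * y P) := by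
        intro P; simp only [Pi.smul_apply, smul_eq_mul]; ring
      simp only [this, ← Finset.mul_sum, hy, mul_zero]
  · intro h
    apply hx0
    funext v
    have := congrFun h (e v)
    rwa [he.extend_apply] at this
  · unfold wt
    rw [Nat.card_eq_fintype_card, Fintype.card_subtype]
    calc _ ≤ (Finset.univ.image e).card := by
          apply Finset.card_le_card
          intro P hP
          simp only [Finset.mem_filter, Finset.mem_univ, true_and] at hP
          by_contra hn
          apply hP
          rw [Function.extend_apply' _ _ _ (by simpa using hn)]
          rfl
      _ ≤ Finset.univ.card := Finset.card_image_le
      _ = _ := by simp [hc']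

lemma trace_count [Fintype F] [DecidableEq F] (hq : 2 ≤ q) (hpp : IsPrimePow q)
    (hF : Fintype.card F = q ^ 2) :
    (Finset.univ.filter (fun v : F => v ^ q + v = 0)).card = q ∧
    (Finset.univ.filter (fun v : F => v ^ q + v = 1)).card = q := by
  obtain ⟨p, n, hp, hn, hpn⟩ := hpp
  have hp' : p.Prime := Nat.prime_iff.2 hp
  haveI : Fact p.Prime := ⟨hp'⟩
  haveI : CharP F p := by
    obtain ⟨r, hr⟩ := CharP.exists F
    obtain ⟨m, hr', hm⟩ := FiniteField.card F r
    have hpr : p = r := by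
      have : p ∣ r ^ (m : ℕ) := by
        rw [← hm, hF, ← hpn]
        exact dvd_pow (dvd_pow_self p hn.ne') (by norm_num)
      exact (Nat.prime_dvd_prime_iff_eq hp' hr').1 (hp'.dvd_of_dvd_pow this)
    rw [hpr]; exact hr
  have hadd : ∀ x y : F, (x + y) ^ q = x ^ q + y ^ q := by
    intro x y
    rw [← hpn]
    exact add_pow_char_pow x y p n
  have hfix : ∀ v : F, (v ^ q + v) ^ q = v ^ q + v := by
    intro v
    rw [hadd, ← pow_mul, ← sq, ← hF, FiniteField.pow_card, add_comm]
  open Polynomial in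
  have hroots : ∀ s : F, s ≠ 0 → (Finset.univ.filter (fun v : F => v ^ q + s * v = 0)).card ≤ q := by
    intro s _
    have hdeg : (X ^ q + C s * X : F[X]).natDegree = q := by
      compute_degree!
      · rw [if_neg (by omega)]; simp
      all_goals omega
    have hne : (X ^ q + C s * X : F[X]) ≠ 0 := by
      intro h
      rw [h] at hdeg
      simp at hdeg
      omega
    calc _ ≤ (X ^ q + C s * X : F[X]).roots.toFinset.card := by
          apply Finset.card_le_card
          intro v hv
          simp only [Finset.mem_filter, Finset.mem_univ, true_and] at hv
          rw [Multiset.mem_toFinset, mem_roots hne]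
          simp [hv]
      _ ≤ Multiset.card (X ^ q + C s * X : F[X]).roots := Multiset.toFinset_card_le _
      _ ≤ _ := card_roots' _
      _ = q := hdeg
  have hK := hroots 1 one_ne_zero
  have hR := hroots (-1) (by simp)
  simp only [one_mul] at hK
  -- fibres
  have hfib : ∀ w : F, ∀ v₀, v₀ ^ q + v₀ = w → (Finset.univ.filter (fun v : F => v ^ q + v = w)).card
      = (Finset.univ.filter (fun v : F => v ^ q + v = 0)).card := by
    intro w v₀ h₀
    symm
    apply Finset.card_bij (fun v _ => v + v₀)
    · intro v hv
      simp only [Finset.mem_filter, Finset.mem_univ, true_and] at hv ⊢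
      rw [hadd]
      linear_combination hv + h₀
    · intro x _ y _ h
      exact add_right_cancel h
    · intro v hv
      simp only [Finset.mem_filter, Finset.mem_univ, true_and] at hv
      refine ⟨v - v₀, ?_, by ring⟩
      simp only [Finset.mem_filter, Finset.mem_univ, true_and]
      have := hadd (v - v₀) v₀
      rw [sub_add_cancel] at this
      linear_combination hv - h₀ - this
  set K := (Finset.univ.filter (fun v : F => v ^ q + v = 0)).card with hKdef
  set I := Finset.univ.image (fun v : F => v ^ q + v) with hI
  have hIsub : I ⊆ Finset.univ.filter (fun v : F => v ^ q + (-1) * v = 0) := by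
    intro w hw
    simp only [hI, Finset.mem_image, Finset.mem_univ, true_and] at hw
    obtain ⟨v, rfl⟩ := hw
    simp only [Finset.mem_filter, Finset.mem_univ, true_and]
    rw [hfix]; ring
  have htot : q ^ 2 = I.card * K := by
    rw [← hF, ← Finset.card_univ, Finset.card_eq_sum_card_image (fun v : F => v ^ q + v)]
    rw [Finset.sum_congr rfl (g := fun _ => K)]
    · simp [hI]
    · intro w hw
      simp only [Finset.mem_image, Finset.mem_univ, true_and] at hw
      obtain ⟨v, hv⟩ := hw
      exact hfib w v hv
  have hIc : I.card ≤ q := (Finset.card_le_card hIsub).trans hR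
  have hKq : K = q := by nlinarith
  have hIq : I.card = q := by nlinarith
  refine ⟨hKq, ?_⟩
  have hIeq : I = Finset.univ.filter (fun v : F => v ^ q + (-1) * v = 0) :=
    Finset.eq_of_subset_of_card_le hIsub (by omega)
  have h1 : (1 : F) ∈ I := by
    rw [hIeq]
    simp
  simp only [hI, Finset.mem_image, Finset.mem_univ, true_and] at h1
  obtain ⟨v, hv⟩ := h1
  rw [hfib 1 v hv, hKq]

end Helpers

/-- Theorem 3.5: if `G = a P∞ + b P₀` with `a = a₀(q+1) + a₁`, `b = b₀(q+1) + b₁`,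
`a₀, b₀ ≥ 0`, `0 ≤ a₁, b₁ ≤ q`, and either `deg G < deg K`, or
`deg K ≤ deg G ≤ deg K + q` with `G` linearly equivalent to a one-point divisor
(i.e. `a₁ = 0` or `b₁ = 0`), then `d(C(a,b)^⊥) = a₀ + b₀ + 2`. -/
theorem minDist_below (q : ℕ) (hq : 2 ≤ q) (hpp : IsPrimePow q)
    (F : Type) [Field F] [Fintype F] (hF : Fintype.card F = q ^ 2)
    (a₀ b₀ a₁ b₁ a b : ℤ)
    (ha₀ : 0 ≤ a₀) (hb₀ : 0 ≤ b₀)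
    (ha₁ : 0 ≤ a₁ ∧ a₁ ≤ (q : ℤ)) (hb₁ : 0 ≤ b₁ ∧ b₁ ≤ (q : ℤ))
    (ha : a = a₀ * ((q : ℤ) + 1) + a₁) (hb : b = b₀ * ((q : ℤ) + 1) + b₁)
    (hrange : a + b < ((q : ℤ) - 2) * ((q : ℤ) + 1) ∨
      (((q : ℤ) - 2) * ((q : ℤ) + 1) ≤ a + b ∧
        a + b ≤ ((q : ℤ) - 2) * ((q : ℤ) + 1) + (q : ℤ) ∧ (a₁ = 0 ∨ b₁ = 0))) :
    (minDist q F a b : ℤ) = a₀ + b₀ + 2 := by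
  classical
  lift a₀ to ℕ using ha₀
  lift b₀ to ℕ using hb₀
  obtain ⟨ha₁0, ha₁q⟩ := ha₁
  obtain ⟨hb₁0, hb₁q⟩ := hb₁
  have hq0 : (0 : ℤ) < (q : ℤ) + 1 := by positivity
  have hkq : (a₀ : ℤ) + b₀ ≤ (q : ℤ) - 2 := by
    have h1 : ((a₀ : ℤ) + b₀) * ((q : ℤ) + 1) < ((q : ℤ) - 1) * ((q : ℤ) + 1) := by
      rcases hrange with h | ⟨_, h, _⟩ <;> nlinarith
    have := lt_of_mul_lt_mul_right h1 hq0.le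
    omega
  obtain ⟨hT0, hT1⟩ := trace_count (F := F) hq hpp hF
  -- bounds on exponents
  have hub : ∀ i j : ℤ, (i, j) ∈ S q a b → i + j ≤ a₀ + (if a₁ = 0 then 0 else if i = 0 then 0 else 1) := by
    rintro i j ⟨h1, h2, h3, h4⟩
    simp only at h1 h2 h3 h4
    split_ifs with h h'
    · subst h
      have : (i + j) * ((q : ℤ) + 1) < ((a₀ : ℤ) + 1) * ((q : ℤ) + 1) := by nlinarith
      have := lt_of_mul_lt_mul_right this hq0.le
      omega
    · subst h'
      have : (0 + j) * ((q : ℤ) + 1) < ((a₀ : ℤ) + 1) * ((q : ℤ) + 1) := by nlinarith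
      have := lt_of_mul_lt_mul_right this hq0.le
      omega
    · have : (i + j) * ((q : ℤ) + 1) < ((a₀ : ℤ) + 2) * ((q : ℤ) + 1) := by nlinarith
      have := lt_of_mul_lt_mul_right this hq0.le
      omega
  have hlb : ∀ i j : ℤ, (i, j) ∈ S q a b → -(b₀ : ℤ) - (if b₁ = 0 then 0 else if i = 0 then 0 else 1) ≤ j := by
    rintro i j ⟨h1, h2, h3, h4⟩
    simp only at h1 h2 h3 h4
    split_ifs with h h'
    · subst h
      have : (-(b₀ : ℤ) - 1) * ((q : ℤ) + 1) < j * ((q : ℤ) + 1) := by nlinarith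
      have := lt_of_mul_lt_mul_right this hq0.le
      omega
    · subst h'
      have : (-(b₀ : ℤ) - 1) * ((q : ℤ) + 1) < j * ((q : ℤ) + 1) := by nlinarith
      have := lt_of_mul_lt_mul_right this hq0.le
      omega
    · have : (-(b₀ : ℤ) - 2) * ((q : ℤ) + 1) < j * ((q : ℤ) + 1) := by nlinarith
      have := lt_of_mul_lt_mul_right this hq0.le
      omega
  have hup : ∃ c ∈ dualCode q F a b, c ≠ 0 ∧ wt c ≤ a₀ + b₀ + 2 := by
    by_cases hsmall : a₀ + b₀ + 3 ≤ q
    · refine upper_s5 a₀ b₀ a b ((Finset.univ.filter (fun v : F => v ^ q + v = 0)).erase 0)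
        (fun _ => 0) ?_ ?_ ?_
      · intro v hv
        simp only [Finset.mem_erase, Finset.mem_filter, Finset.mem_univ, true_and] at hv
        refine ⟨by simp [hv.2], ?_⟩
        intro h
        exact hv.1 (congrArg Prod.snd h)
      · rw [Finset.card_erase_of_mem (by simp [zero_pow (show q ≠ 0 by omega)]), hT0]
        omega
      · rintro ⟨i, j⟩ hij
        have h1 := hub i j hij
        have h2 := hlb i j hij
        by_cases hi : i = 0
        · subst hi
          refine ⟨1, j, Or.inl ⟨?_, ?_⟩, ?_⟩
          · simpa using h2
          · simpa using h1
          · intro v _; simp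
        · refine ⟨0, 0, Or.inr rfl, ?_⟩
          intro v _
          simp [zero_zpow i hi]
    · have hcase : a₁ = 0 ∨ b₁ = 0 := by
        rcases hrange with h | ⟨_, _, h⟩
        · exfalso
          have : (q : ℤ) - 2 ≤ (a₀ : ℤ) + b₀ := by omega
          nlinarith
        · exact h
      by_cases hb1 : b₁ = 0
      · refine upper_s5 a₀ b₀ a b (Finset.univ.filter (fun v : F => v ^ q + v = 1))
          (fun _ => 1) ?_ ?_ ?_
        · intro v hv
          simp only [Finset.mem_filter, Finset.mem_univ, true_and] at hv
          refine ⟨by simp [hv], ?_⟩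
          intro h
          exact one_ne_zero (congrArg Prod.fst h)
        · rw [hT1]
          omega
        · rintro ⟨i, j⟩ hij
          have h1 := hub i j hij
          have h2 := hlb i j hij
          have h0 : 0 ≤ i := hij.1
          refine ⟨1, j, Or.inl ⟨?_, ?_⟩, ?_⟩
          · simpa [hb1] using h2
          · split_ifs at h1 <;> omega
          · intro v _; simp
      · have ha1 : a₁ = 0 := by tauto
        refine upper_s5 a₀ b₀ a b ((Finset.univ.filter (fun v : F => v ^ q + v = 1)).image (fun v => v⁻¹))
          (fun v => v) ?_ ?_ ?_
        · intro v hv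
          simp only [Finset.mem_image, Finset.mem_filter, Finset.mem_univ, true_and] at hv
          obtain ⟨w, hw, rfl⟩ := hv
          have hw0 : w ≠ 0 := by
            rintro rfl
            simp [zero_pow (show q ≠ 0 by omega)] at hw
          refine ⟨?_, ?_⟩
          · simp only [inv_pow, pow_succ]
            have := pow_ne_zero q hw0
            field_simp
            linear_combination hw
          · intro h
            exact inv_ne_zero hw0 (congrArg Prod.fst h)
        · rw [Finset.card_image_of_injective _ inv_injective, hT1]
          omega
        · rintro ⟨i, j⟩ hij
          have h1 := hub i j hij
          have h2 := hlb i j hij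
          have h0 : 0 ≤ i := hij.1
          refine ⟨1, i + j, Or.inl ⟨?_, ?_⟩, ?_⟩
          · split_ifs at h2 <;> omega
          · simpa [ha1] using h1
          · intro v hv
            simp only [Finset.mem_image, Finset.mem_filter, Finset.mem_univ, true_and] at hv
            obtain ⟨w, hw, rfl⟩ := hv
            have hw0 : w ≠ 0 := by
              rintro rfl
              simp [zero_pow (show q ≠ 0 by omega)] at hw
            rw [zpow_add₀ (inv_ne_zero hw0), one_mul]
  have hlow := lower_s5 (F := F) hq a₀ b₀ a b (by omega) (by omega) (by omega)
  obtain ⟨c, hc, hc0, hcw⟩ := hup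
  have hle : minDist q F a b ≤ wt c := Nat.sInf_le ⟨c, hc, hc0, rfl⟩
  obtain ⟨c', hc', hc0', hcw'⟩ : minDist q F a b ∈
      {w | ∃ c ∈ dualCode q F a b, c ≠ 0 ∧ wt c = w} := Nat.sInf_mem ⟨_, c, hc, hc0, rfl⟩
  have := hlow c' hc' hc0'
  omega

end HermitianTwoPoint
end

section
/- Let F be a field, let m, n be positive integers, let c = (c₁,…,cₙ) ∈ Fⁿ, and let A and B be m × n matrices over F. Suppose the m × m matrix M = A · diag(c₁,…,cₙ) · Bᵀ is zero below the diagonal (M_{ij} = 0 for all i > j) and nonzero on the diagonal (M_{ii} ≠ 0 for all i). Then c has at least m nonzero coordinates, i.e., its Hamming weight is at least m. -/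
/-- The linear-algebra core of the shift bound: if `A · diag(c) · Bᵀ` is zero below the
diagonal and nonzero on the diagonal, then `c` has at least `m` nonzero coordinates. -/
theorem shift_bound_core (F : Type) [Field F] (m n : ℕ) (hm : 0 < m) (hn : 0 < n)
    (c : Fin n → F) (A B : Matrix (Fin m) (Fin n) F)
    (M : Matrix (Fin m) (Fin m) F)
    (hM : M = A * Matrix.diagonal c * B.transpose)
    (hlow : ∀ i j : Fin m, j < i → M i j = 0)
    (hdiag : ∀ i : Fin m, M i i ≠ 0) :
    m ≤ Nat.card {k : Fin n // c k ≠ 0} := by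
  classical
  have hdet : M.det ≠ 0 := by
    rw [Matrix.det_of_upperTriangular (fun i j h => hlow i j h)]
    exact Finset.prod_ne_zero_iff.mpr fun i _ => hdiag i
  have hrank : M.rank = m := by
    rw [Matrix.rank_of_isUnit M ((Matrix.isUnit_iff_isUnit_det M).mpr hdet.isUnit),
      Fintype.card_fin]
  calc m = M.rank := hrank.symm
    _ ≤ (A * Matrix.diagonal c).rank := by
      rw [hM]
      exact Matrix.rank_mul_le_left _ _
    _ ≤ (Matrix.diagonal c).rank := Matrix.rank_mul_le_right _ _
    _ = Nat.card {k : Fin n // c k ≠ 0} := by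
      rw [Matrix.rank_diagonal, Nat.card_eq_fintype_card]
end

section
/- Let q ≥ 1 and let a₀, b₀, a₁, b₁ be integers with 0 ≤ b₁ ≤ a₀ + b₀ ≤ a₁ ≤ q. Then the minimum, over all integers a₁′ with a₀ + b₀ ≤ a₁′ ≤ a₁, of the quantity a₁′(q + a₀ + b₀ − a₁′) − min{a₁′, b₁} equals (a₀ + b₀)q − b₁; equivalently, writing d* = (a₀ + b₀)(q+1) − a₁ − b₁, this minimum equals d* + a₁ − (a₀ + b₀). -/
/-- Lemma 5.1 via the multiplicity formula of Proposition 3.1: for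
`0 ≤ b₁ ≤ a₀ + b₀ ≤ a₁ ≤ q`, the minimum over `a₀ + b₀ ≤ x ≤ a₁` of
`x(q + a₀ + b₀ - x) - min{x, b₁}` equals `(a₀ + b₀) q - b₁`, which equals
`d* + a₁ - (a₀ + b₀)` for `d* = (a₀ + b₀)(q + 1) - a₁ - b₁`. -/
theorem min_multiplicity_I₂ (q : ℕ) (hq : 1 ≤ q) (a₀ b₀ a₁ b₁ : ℤ)
    (hb₁ : 0 ≤ b₁) (h1 : b₁ ≤ a₀ + b₀) (h2 : a₀ + b₀ ≤ a₁) (h3 : a₁ ≤ (q : ℤ)) :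
    IsLeast {v : ℤ | ∃ x : ℤ, a₀ + b₀ ≤ x ∧ x ≤ a₁ ∧
        v = x * ((q : ℤ) + a₀ + b₀ - x) - min x b₁} ((a₀ + b₀) * (q : ℤ) - b₁) ∧
      (a₀ + b₀) * (q : ℤ) - b₁ =
        (((a₀ + b₀) * ((q : ℤ) + 1) - a₁ - b₁) + a₁ - (a₀ + b₀)) := by
  refine ⟨⟨⟨a₀ + b₀, le_refl _, h2, ?_⟩, ?_⟩, by ring⟩
  · rw [min_eq_right h1]
    ring
  · rintro v ⟨x, hx1, hx2, rfl⟩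
    rw [min_eq_right (h1.trans hx1)]
    have h : 0 ≤ (x - (a₀ + b₀)) * ((q : ℤ) - x) :=
      mul_nonneg (by linarith) (by linarith)
    nlinarith [h]
end

section
/- Let q ≥ 1 and let a₀, b₀, a₁, b₁ be integers with a₀ + b₀ ≤ a₁ ≤ b₁ < q and a₁ ≥ 0, b₁ ≥ 0, a₀ + b₀ ≥ 0. Then the minimum, over all integers a₁′ with a₀ + b₀ ≤ a₁′ ≤ a₁, of the quantity a₁′(q + a₀ + b₀ − a₁′) − min{a₁′, b₁} equals (a₀ + b₀)(q − 1); equivalently, writing d* = (a₀ + b₀)(q+1) − a₁ − b₁, this minimum equals d* + a₁ + b₁ − 2(a₀ + b₀). -/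
/-- Lemma 5.2 via the multiplicity formula of Proposition 3.1: for
`0 ≤ a₀ + b₀ ≤ a₁ ≤ b₁ < q` with `a₁, b₁ ≥ 0`, the minimum over `a₀ + b₀ ≤ x ≤ a₁` of
`x(q + a₀ + b₀ - x) - min{x, b₁}` equals `(a₀ + b₀)(q - 1)`, which equals
`d* + a₁ + b₁ - 2(a₀ + b₀)` for `d* = (a₀ + b₀)(q + 1) - a₁ - b₁`. -/
theorem min_multiplicity_I₃ (q : ℕ) (hq : 1 ≤ q) (a₀ b₀ a₁ b₁ : ℤ)
    (ha₁ : 0 ≤ a₁) (hb₁ : 0 ≤ b₁) (h0 : 0 ≤ a₀ + b₀)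
    (h1 : a₀ + b₀ ≤ a₁) (h2 : a₁ ≤ b₁) (h3 : b₁ < (q : ℤ)) :
    IsLeast {v : ℤ | ∃ x : ℤ, a₀ + b₀ ≤ x ∧ x ≤ a₁ ∧
        v = x * ((q : ℤ) + a₀ + b₀ - x) - min x b₁} ((a₀ + b₀) * ((q : ℤ) - 1)) ∧
      (a₀ + b₀) * ((q : ℤ) - 1) =
        (((a₀ + b₀) * ((q : ℤ) + 1) - a₁ - b₁) + a₁ + b₁ - 2 * (a₀ + b₀)) := by
  refine ⟨⟨⟨a₀ + b₀, le_refl _, h1, ?_⟩, ?_⟩, by ring⟩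
  · rw [min_eq_left (by linarith)]
    ring
  · rintro v ⟨x, hx1, hx2, rfl⟩
    rw [min_eq_left (by linarith)]
    have hs : 0 ≤ x - (a₀ + b₀) := by linarith
    have ht : 0 ≤ (q : ℤ) - 1 - x := by omega
    have key := mul_nonneg hs ht
    linarith [key]
end

section
/- The number of pairs (u,v) ∈ F × F with v^q + v = u^{q+1}, u ≠ 0 and v ∉ F_q equals q³ − q² − q + 1 if q is odd, and equals q³ − q if q is even. (Point count in the proof of Lemma 5.4.) -/
theorem aux_card_roots (F : Type) [Field F] (q : ℕ) (hq : 2 ≤ q) (a : F) :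
    Nat.card {v : F // v ^ q + a * v = 0} ≤ q := by
  classical
  have hd : (Polynomial.X ^ q + Polynomial.C a * Polynomial.X : Polynomial F).natDegree = q := by
    rw [Polynomial.natDegree_add_eq_left_of_natDegree_lt]
    · simp
    · rw [Polynomial.natDegree_X_pow]
      exact lt_of_le_of_lt (Polynomial.natDegree_C_mul_le a _) (by rw [Polynomial.natDegree_X]; omega)
  have hne : (Polynomial.X ^ q + Polynomial.C a * Polynomial.X : Polynomial F) ≠ 0 := by
    intro h
    rw [h] at hd
    simp at hd
    omega
  have h1 : {v : F | v ^ q + a * v = 0} =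
      ((Polynomial.X ^ q + Polynomial.C a * Polynomial.X : Polynomial F).roots.toFinset : Set F) := by
    ext v
    simp [hne]
  have h2 : Nat.card {v : F // v ^ q + a * v = 0} = Set.ncard {v : F | v ^ q + a * v = 0} := rfl
  rw [h2, h1, Set.ncard_coe_finset]
  exact (Multiset.toFinset_card_le _).trans ((Polynomial.card_roots' _).trans hd.le)

theorem aux_fiber (q : ℕ) (hq : 2 ≤ q)
    (F : Type) [Field F] [Fintype F] (hF : Fintype.card F = q ^ 2)
    (hadd : ∀ x y : F, (x + y) ^ q = x ^ q + y ^ q) (c : F) (hc : c ^ q = c) :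
    Nat.card {v : F // v ^ q + v = c} = q := by
  classical
  have hqq : ∀ x : F, (x ^ q) ^ q = x := fun x => by
    rw [← pow_mul, ← pow_two, ← hF, FiniteField.pow_card]
  let T : F →+ F := AddMonoidHom.mk' (fun v => v ^ q + v) (fun x y => by
    simp only [hadd]; ring)
  have hT : ∀ v, T v = v ^ q + v := fun v => rfl
  have hk : Nat.card T.ker ≤ q := by
    refine le_trans (le_of_eq ?_) (aux_card_roots F q hq 1)
    apply Nat.card_congr
    exact Equiv.subtypeEquivRight (fun v => by rw [AddMonoidHom.mem_ker, hT, one_mul])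
  have hm : Nat.card T.ker * Nat.card T.range = q ^ 2 := by
    rw [← AddSubgroup.index_ker, AddSubgroup.card_mul_index, Nat.card_eq_fintype_card, hF]
  have hfix : Set.ncard {v : F | v ^ q = v} ≤ q := by
    refine le_trans (le_of_eq ?_) (aux_card_roots F q hq (-1))
    apply Nat.card_congr
    exact Equiv.subtypeEquivRight (fun v => by
      show v ^ q = v ↔ _
      rw [neg_one_mul, ← sub_eq_add_neg, sub_eq_zero])
  have hsub : (T.range : Set F) ⊆ {v : F | v ^ q = v} := by
    rintro _ ⟨v, rfl⟩
    show (v ^ q + v) ^ q = v ^ q + v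
    rw [hadd, hqq, add_comm]
  have hr : Nat.card T.range = Set.ncard (T.range : Set F) := rfl
  have hle := Set.ncard_le_ncard hsub (Set.toFinite _)
  have hkq : Nat.card T.ker = q := by nlinarith
  have hrq : Nat.card T.range = q := by
    rw [hkq] at hm
    nlinarith
  have heq := Set.eq_of_subset_of_ncard_le hsub (by omega) (Set.toFinite _)
  have hcr : c ∈ (T.range : Set F) := by rw [heq]; exact hc
  obtain ⟨v₀, hv₀⟩ := hcr
  refine Eq.trans ?_ hkq
  apply Nat.card_congr
  refine (Equiv.subRight v₀).subtypeEquiv (fun v => ?_)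
  rw [AddMonoidHom.mem_ker, Equiv.subRight_apply, map_sub, hv₀, sub_eq_zero, hT]

/-- Point count in the proof of Lemma 5.4: the number of points `(u,v)` of the affine
Hermitian curve with `u ≠ 0` and `v ∉ F_q` equals `q³ - q² - q + 1` for odd `q`
and `q³ - q` for even `q`. -/
theorem count_points_off_lines (q : ℕ) (hq : 2 ≤ q) (hpp : IsPrimePow q)
    (F : Type) [Field F] [Fintype F] (hF : Fintype.card F = q ^ 2) :
    (Odd q →
      (Nat.card {p : F × F // p.2 ^ q + p.2 = p.1 ^ (q + 1) ∧ p.1 ≠ 0 ∧ p.2 ^ q ≠ p.2} : ℤ) =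
        (q : ℤ) ^ 3 - (q : ℤ) ^ 2 - (q : ℤ) + 1) ∧
    (Even q →
      (Nat.card {p : F × F // p.2 ^ q + p.2 = p.1 ^ (q + 1) ∧ p.1 ≠ 0 ∧ p.2 ^ q ≠ p.2} : ℤ) =
        (q : ℤ) ^ 3 - (q : ℤ)) := by
  classical
  obtain ⟨p, k, hp, hk, rfl⟩ := hpp
  have hp' := hp.nat_prime
  have : Fact p.Prime := ⟨hp'⟩
  have : CharP F p := by
    obtain ⟨r, hr⟩ := CharP.exists F
    obtain ⟨n, hrp, hn⟩ := FiniteField.card F r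
    have : r ∣ (p ^ k) ^ 2 := by rw [← hF, hn]; exact dvd_pow_self _ n.ne_zero
    have := (Nat.prime_dvd_prime_iff_eq hrp hp').1
      (hrp.dvd_of_dvd_pow (hrp.dvd_of_dvd_pow this))
    rwa [← this]
  have hadd : ∀ x y : F, (x + y) ^ (p ^ k) = x ^ (p ^ k) + y ^ (p ^ k) :=
    fun x y => add_pow_char_pow x y p k
  have hpar : p ∣ p ^ k := dvd_pow_self _ hk.ne'
  generalize hqd : p ^ k = q at *
  have hqq : ∀ x : F, (x ^ q) ^ q = x := fun x => by
    rw [← pow_mul, ← pow_two, ← hF, FiniteField.pow_card]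
  have hN : ∀ u : F, (u ^ (q + 1)) ^ q = u ^ (q + 1) := fun u => by
    rw [pow_succ, mul_pow, hqq, mul_comm]
  have key : ∀ m : ℕ, (∀ u : F, u ≠ 0 →
      Nat.card {v : F // v ^ q + v = u ^ (q + 1) ∧ v ^ q ≠ v} = m) →
      Nat.card {p : F × F // p.2 ^ q + p.2 = p.1 ^ (q + 1) ∧ p.1 ≠ 0 ∧ p.2 ^ q ≠ p.2}
        = (q ^ 2 - 1) * m := by
    intro m hm
    let e : {p : F × F // p.2 ^ q + p.2 = p.1 ^ (q + 1) ∧ p.1 ≠ 0 ∧ p.2 ^ q ≠ p.2} ≃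
        Σ u : {u : F // u ≠ 0}, {v : F // v ^ q + v = u.1 ^ (q + 1) ∧ v ^ q ≠ v} :=
      { toFun := fun x => ⟨⟨x.1.1, x.2.2.1⟩, ⟨x.1.2, x.2.1, x.2.2.2⟩⟩
        invFun := fun y => ⟨(y.1.1, y.2.1), y.2.2.1, y.1.2, y.2.2.2⟩
        left_inv := fun _ => rfl
        right_inv := fun _ => rfl }
    rw [Nat.card_congr e, Nat.card_sigma, Finset.sum_congr rfl (fun u _ => hm u.1 u.2)]
    rw [Finset.sum_const, smul_eq_mul, Finset.card_univ, Fintype.card_subtype_compl, hF]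
    simp
  have h1q : 1 ≤ q ^ 2 := Nat.one_le_pow _ _ (by omega)
  constructor
  · intro hodd
    have h2 : (2 : F) ≠ 0 := by
      intro h
      have h3 : ((2 : ℕ) : F) = 0 := by exact_mod_cast h
      rw [CharP.cast_eq_zero_iff F p] at h3
      have := (Nat.prime_dvd_prime_iff_eq hp' Nat.prime_two).1 h3
      subst this
      rcases hodd with ⟨j, hj⟩
      omega
    have h2q : (2 : F) ^ q = 2 := by
      have := hadd 1 1
      rw [one_pow] at this
      norm_num at this
      exact this
    rw [key (q - 1)]
    · rw [Nat.cast_mul, Nat.cast_sub h1q, Nat.cast_sub (by omega)]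
      push_cast
      ring
    · intro u hu
      have hf := aux_fiber q hq F hF hadd _ (hN u)
      have hs : Nat.card {v : F // v ^ q + v = u ^ (q + 1) ∧ v ^ q ≠ v} =
        Set.ncard ({v : F | v ^ q + v = u ^ (q + 1)} \ {u ^ (q + 1) / 2}) := by
        apply Nat.card_congr
        refine Equiv.subtypeEquivRight (fun v => ?_)
        show _ ↔ (v ^ q + v = u ^ (q + 1) ∧ v ≠ u ^ (q + 1) / 2)
        refine and_congr_right (fun h => not_congr ?_)
        rw [eq_div_iff h2, ← h]
        constructor
        · intro h'; rw [h']; ring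
        · intro h'; linear_combination -h'
      rw [hs, Set.ncard_sdiff_singleton_of_mem]
      · exact congrArg (· - 1) hf
      · show (u ^ (q + 1) / 2) ^ q + u ^ (q + 1) / 2 = u ^ (q + 1)
        rw [div_pow, hN, h2q]
        field_simp
        ring
  · intro heven
    have h2 : (2 : F) = 0 := by
      have : 2 ∣ p := by
        have h := heven.two_dvd
        rw [← hqd] at h
        exact Nat.prime_two.dvd_of_dvd_pow h
      have h3 : ((2 : ℕ) : F) = 0 := by
        rw [CharP.cast_eq_zero_iff F p, (Nat.prime_dvd_prime_iff_eq Nat.prime_two hp').1 this]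
      exact_mod_cast h3
    rw [key q]
    · rw [Nat.cast_mul, Nat.cast_sub h1q]
      push_cast
      ring
    · intro u hu
      refine Eq.trans ?_ (aux_fiber q hq F hF hadd _ (hN u))
      apply Nat.card_congr
      refine Equiv.subtypeEquivRight (fun v => ?_)
      refine ⟨fun h => h.1, fun h => ⟨h, fun h' => ?_⟩⟩
      rw [h', ← two_mul, h2, zero_mul] at h
      exact pow_ne_zero _ hu h.symm
end

section
/- Let (u,v) ∈ F × F satisfy v^q + v = u^{q+1} with u ≠ 0 and v ∉ F_q, and set α = u²v^{−1}. Then {(x,y) ∈ F × F : y^q + y = x^{q+1}, x² = αy, (x,y) ≠ (0,0)} = {(au, a²v) : a ∈ F_q, a ≠ 0} ∪ {(auv^{−1}, a²v^{−1}) : a ∈ F_q, a ≠ 0}, and this set has exactly 2(q − 1) elements. In particular, the function x² − αy vanishes on the Hermitian curve at the origin and at exactly 2q − 2 further distinct rational points, including (u,v). (Lemma 5.4.) -/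
theorem fq_card (q : ℕ) (hq : 2 ≤ q) (F : Type) [Field F] [Fintype F]
    (hF : Fintype.card F = q ^ 2) : ({a : F | a ^ q = a ∧ a ≠ 0}).ncard = q - 1 := by
  classical
  obtain ⟨m, rfl⟩ : ∃ m, q = m + 1 := ⟨q - 1, by omega⟩
  have hset : {a : F | a ^ (m + 1) = a ∧ a ≠ 0} =
      (fun x : Fˣ => (x : F)) '' ((powMonoidHom m : Fˣ →* Fˣ).ker : Set Fˣ) := by
    ext a
    simp only [Set.mem_setOf_eq, Set.mem_image, SetLike.mem_coe, MonoidHom.mem_ker,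
      powMonoidHom_apply]
    constructor
    · rintro ⟨h, h0⟩
      refine ⟨Units.mk0 a h0, ?_, rfl⟩
      ext
      push_cast
      apply mul_right_cancel₀ h0
      simpa [pow_succ] using h
    · rintro ⟨x, hx, rfl⟩
      refine ⟨?_, x.ne_zero⟩
      rw [pow_succ, ← Units.val_pow_eq_pow_val, hx]; simp
  rw [hset, Set.ncard_image_of_injective _ Units.val_injective]
  have hc : Nat.card Fˣ = m * (m + 2) := by
    rw [Nat.card_units, Nat.card_eq_fintype_card, hF]
    have : (m + 1) ^ 2 = m * (m + 2) + 1 := by ring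
    omega
  change Nat.card (powMonoidHom m : Fˣ →* Fˣ).ker = _
  rw [IsCyclic.card_powMonoidHom_ker, hc]
  simp

/-- Lemma 5.4: for a point `(u,v)` of the Hermitian curve with `u ≠ 0`, `v ∉ F_q`, and
`α = u² v⁻¹`, the common zeros of `y^q + y - x^(q+1)` and `x² - αy` other than the origin
form the single orbit `{(au, a²v)} ∪ {(auv⁻¹, a²v⁻¹)}` (`a ∈ F_q \ {0}`) of `2(q-1)`
distinct points. -/
theorem conic_zeros (q : ℕ) (hq : 2 ≤ q) (hpp : IsPrimePow q)
    (F : Type) [Field F] [Fintype F] (hF : Fintype.card F = q ^ 2)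
    (u v : F) (hcurve : v ^ q + v = u ^ (q + 1)) (hu : u ≠ 0) (hv : v ^ q ≠ v)
    (α : F) (hα : α = u ^ 2 * v⁻¹) :
    ({p : F × F | p.2 ^ q + p.2 = p.1 ^ (q + 1) ∧ p.1 ^ 2 = α * p.2 ∧ p ≠ 0} =
        {p : F × F | ∃ a : F, a ^ q = a ∧ a ≠ 0 ∧ p = (a * u, a ^ 2 * v)} ∪
        {p : F × F | ∃ a : F, a ^ q = a ∧ a ≠ 0 ∧ p = (a * u * v⁻¹, a ^ 2 * v⁻¹)}) ∧
      ({p : F × F | p.2 ^ q + p.2 = p.1 ^ (q + 1) ∧ p.1 ^ 2 = α * p.2 ∧ p ≠ 0}).ncard =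
        2 * (q - 1) := by
  have hq0 : q ≠ 0 := by omega
  have hv0 : v ≠ 0 := by
    rintro rfl
    exact hv (zero_pow hq0)
  have hα0 : α ≠ 0 := by
    rw [hα]; exact mul_ne_zero (pow_ne_zero _ hu) (inv_ne_zero hv0)
  have hVq : v ^ q ≠ 0 := pow_ne_zero _ hv0
  have hset : ({p : F × F | p.2 ^ q + p.2 = p.1 ^ (q + 1) ∧ p.1 ^ 2 = α * p.2 ∧ p ≠ 0} =
        {p : F × F | ∃ a : F, a ^ q = a ∧ a ≠ 0 ∧ p = (a * u, a ^ 2 * v)} ∪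
        {p : F × F | ∃ a : F, a ^ q = a ∧ a ≠ 0 ∧ p = (a * u * v⁻¹, a ^ 2 * v⁻¹)}) := by
    ext ⟨x, y⟩
    simp only [Set.mem_setOf_eq, Set.mem_union, Prod.mk.injEq, ne_eq, Prod.mk_eq_zero]
    constructor
    · rintro ⟨h1, h2, h3⟩
      have hx : x ≠ 0 := by
        rintro rfl
        have : α * y = 0 := by rw [← h2]; ring
        exact h3 ⟨rfl, (mul_eq_zero.mp this).resolve_left hα0⟩
      obtain ⟨c, rfl⟩ : ∃ c, x = c * u := ⟨x * u⁻¹, by field_simp⟩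
      have hc : c ≠ 0 := left_ne_zero_of_mul hx
      have hy : y = c ^ 2 * v := by
        apply mul_left_cancel₀ hα0
        rw [← h2, hα]; field_simp
      subst hy
      have key : (c ^ q - c) * (c ^ q * v ^ q - c * v) = 0 := by
        have e1 : (c * u) ^ (q + 1) = c ^ q * c * (v ^ q + v) := by
          rw [hcurve]; ring
        have e2 : (c ^ 2 * v) ^ q = (c ^ q) ^ 2 * v ^ q := by ring
        rw [e1, e2] at h1
        linear_combination h1
      rcases mul_eq_zero.mp key with h | h
      · exact Or.inl ⟨c, sub_eq_zero.mp h, hc, rfl, rfl⟩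
      · refine Or.inr ⟨c * v, ?_, mul_ne_zero hc hv0, ?_, ?_⟩
        · rw [mul_pow]; exact sub_eq_zero.mp h
        · field_simp
        · field_simp
    · rintro (⟨a, ha, ha0, rfl, rfl⟩ | ⟨a, ha, ha0, rfl, rfl⟩)
      · refine ⟨?_, ?_, ?_⟩
        · have e1 : (a * u) ^ (q + 1) = a ^ q * a * (v ^ q + v) := by
            rw [hcurve]; ring
          have e2 : (a ^ 2 * v) ^ q = (a ^ q) ^ 2 * v ^ q := by ring
          rw [e1, e2, ha]; ring
        · rw [hα]; field_simp
        · exact fun h => mul_ne_zero ha0 hu h.1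
      · refine ⟨?_, ?_, ?_⟩
        · have e1 : (a * u * v⁻¹) ^ (q + 1) = a ^ q * a * (v ^ q + v) * ((v ^ q)⁻¹ * v⁻¹) := by
            rw [hcurve, ← inv_pow]; ring
          have e2 : (a ^ 2 * v⁻¹) ^ q = (a ^ q) ^ 2 * (v ^ q)⁻¹ := by
            rw [← inv_pow]; ring
          rw [e1, e2, ha]
          generalize v ^ q = V at *
          field_simp
          ring
        · rw [hα]; field_simp
        · exact fun h => mul_ne_zero (mul_ne_zero ha0 hu) (inv_ne_zero hv0) h.1
  refine ⟨hset, ?_⟩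
  rw [hset]
  have hcard : ({a : F | a ^ q = a ∧ a ≠ 0}).ncard = q - 1 := fq_card q hq F hF
  have i1 : {p : F × F | ∃ a : F, a ^ q = a ∧ a ≠ 0 ∧ p = (a * u, a ^ 2 * v)} =
      (fun a : F => (a * u, a ^ 2 * v)) '' {a : F | a ^ q = a ∧ a ≠ 0} := by
    ext p; simp only [Set.mem_setOf_eq, Set.mem_image, and_assoc, eq_comm]
  have i2 : {p : F × F | ∃ a : F, a ^ q = a ∧ a ≠ 0 ∧ p = (a * u * v⁻¹, a ^ 2 * v⁻¹)} =
      (fun a : F => (a * u * v⁻¹, a ^ 2 * v⁻¹)) '' {a : F | a ^ q = a ∧ a ≠ 0} := by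
    ext p; simp only [Set.mem_setOf_eq, Set.mem_image, and_assoc, eq_comm]
  rw [Set.ncard_union_eq _ (Set.toFinite _) (Set.toFinite _), i1, i2,
    Set.ncard_image_of_injective, Set.ncard_image_of_injective, hcard]
  · omega
  · intro a b h
    have h1 := (Prod.mk.inj h).1
    exact mul_right_cancel₀ hu (mul_right_cancel₀ (inv_ne_zero hv0) h1)
  · intro a b h
    have h1 := (Prod.mk.inj h).1
    exact mul_right_cancel₀ hu h1
  · rw [Set.disjoint_left]
    rintro p ⟨a, ha, ha0, rfl⟩ ⟨b, hb, hb0, h⟩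
    have h1 := (Prod.mk.inj h).1
    have h2 : b = a * v := by
      field_simp at h1
      exact h1.symm
    rw [h2, mul_pow, ha] at hb
    exact hv (mul_left_cancel₀ ha0 hb)
end

section
/- The set {u²v^{−1} : (u,v) ∈ F × F, v^q + v = u^{q+1}, u ≠ 0, v ∉ F_q} of values α for which the conic x² = αy meets the Hermitian curve as in Lemma 5.4 has cardinality (q² − 1)/2 if q is odd, and (q² + q)/2 if q is even. (Lemma 5.4, count of conics.) -/
open Polynomial in
lemma card_filter_root_le {F : Type} [Field F] [Fintype F] [DecidableEq F] (p : F[X]) (hp : p ≠ 0)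
    (d : ℕ) (hd : p.natDegree ≤ d) (P : F → Prop) [DecidablePred P] (s : Finset F)
    (h : ∀ x, P x → p.eval x = 0) : (s.filter P).card ≤ d := by
  refine le_trans (Finset.card_le_card (t := p.roots.toFinset) ?_)
    ((Multiset.toFinset_card_le _).trans ((Polynomial.card_roots' p).trans hd))
  intro x hx
  simp only [Finset.mem_filter] at hx
  simp [hp, Polynomial.IsRoot, h x hx.2]

lemma fibres_full {α β : Type} [DecidableEq β] (s : Finset α) (t : Finset β) (f : α → β)
    (hf : ∀ x ∈ s, f x ∈ t) (a b : ℕ) (ha : 0 < a) (hfib : ∀ y ∈ t, (s.filter (f · = y)).card ≤ a)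
    (ht : t.card ≤ b) (hs : s.card = a * b) :
    t.card = b ∧ ∀ y ∈ t, (s.filter (f · = y)).card = a := by
  have h := Finset.card_eq_sum_card_fiberwise (s := s) (t := t) (f := f) hf
  have h2 : ∑ y ∈ t, (s.filter (f · = y)).card ≤ ∑ y ∈ t, a := Finset.sum_le_sum hfib
  have h3 : t.card = b := by
    apply le_antisymm ht
    rw [Finset.sum_const, smul_eq_mul] at h2
    have : a * b ≤ a * t.card := by rw [← hs, h, mul_comm a]; exact h2
    exact Nat.le_of_mul_le_mul_left this ha
  refine ⟨h3, ?_⟩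
  have h4 : ∑ y ∈ t, (s.filter (f · = y)).card = ∑ y ∈ t, a := by
    rw [← h, hs, Finset.sum_const, smul_eq_mul, h3, mul_comm]
  exact (Finset.sum_eq_sum_iff_of_le hfib).1 h4

open Polynomial in
lemma trace_fibre (q : ℕ) (hq : 2 ≤ q) (F : Type) [Field F] [Fintype F] [DecidableEq F]
    (hF : Fintype.card F = q ^ 2) (hadd : ∀ x y : F, (x + y) ^ q = x ^ q + y ^ q) :
    (Finset.univ.filter (fun g : F => g ^ q + g = 1)).card = q := by
  have hqq : ∀ x : F, (x ^ q) ^ q = x := fun x => by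
    rw [← pow_mul, ← sq, ← hF, FiniteField.pow_card]
  have := fibres_full (Finset.univ : Finset F) (Finset.univ.filter (fun a : F => a ^ q = a))
    (fun g => g ^ q + g) (by intro x _; simp [hadd, hqq, add_comm]) q q (by omega)
    (by
      intro c _
      have hd : (X ^ q + X - C c : F[X]).natDegree = q := by
        have : (X - C c : F[X]).degree < q := by
          rw [degree_X_sub_C]; exact_mod_cast hq
        rw [add_sub_assoc, natDegree_add_eq_left_of_degree_lt (by rwa [degree_X_pow]),
          natDegree_X_pow]
      refine card_filter_root_le (X ^ q + X - C c) ?_ q hd.le _ _ ?_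
      · intro h0; rw [h0] at hd; simp at hd; omega
      · intro x hx; simp [hx])
    (by
      refine card_filter_root_le (X ^ q - X) (FiniteField.X_pow_card_sub_X_ne_zero F (by omega)) q
        (FiniteField.X_pow_card_sub_X_natDegree_eq F (by omega)).le _ _ ?_
      intro x hx; simp [hx])
    (by rw [Finset.card_univ, hF, sq])
  exact this.2 1 (by simp)

open Polynomial in
lemma norm_one (q : ℕ) (hq : 2 ≤ q) (F : Type) [Field F] [Fintype F] [DecidableEq F]
    (hF : Fintype.card F = q ^ 2) :
    (Finset.univ.filter (fun w : F => w ^ (q + 1) = 1)).card = q + 1 ∧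
    ∀ w : F, w ^ (q + 1) = 1 → ∃ u : F, u ≠ 0 ∧ u ^ (q - 1) = w := by
  obtain ⟨n, rfl⟩ : ∃ n, q = n + 1 := ⟨q - 1, by omega⟩
  have hc : Fintype.card F - 1 = n * (n + 1 + 1) := by
    rw [hF]; apply Nat.sub_eq_of_eq_add; ring
  have := fibres_full (Finset.univ.filter (fun u : F => u ≠ 0))
    (Finset.univ.filter (fun w : F => w ^ (n + 1 + 1) = 1))
    (fun u => u ^ n) (by
      intro x hx
      simp only [Finset.mem_filter, Finset.mem_univ, true_and] at hx ⊢
      rw [← pow_mul, ← hc, FiniteField.pow_card_sub_one_eq_one x hx]) n (n + 1 + 1) (by omega)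
    (by
      intro c _
      refine card_filter_root_le (X ^ n - C c) (X_pow_sub_C_ne_zero (by omega) c) n
        natDegree_X_pow_sub_C.le _ _ ?_
      intro x hx; simp [hx])
    (by
      refine card_filter_root_le (X ^ (n + 1 + 1) - C 1) (X_pow_sub_C_ne_zero (by omega) 1) _
        natDegree_X_pow_sub_C.le _ _ ?_
      intro x hx; simp [hx])
    (by rw [← hc, Finset.filter_ne', Finset.card_erase_of_mem (Finset.mem_univ _),
      Finset.card_univ])
  refine ⟨this.1, fun w hw => ?_⟩
  have h := this.2 w (by simpa using hw)
  obtain ⟨u, hu⟩ := Finset.card_pos.1 (by rw [h]; omega)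
  simp only [Finset.mem_filter, Finset.mem_univ, true_and] at hu
  exact ⟨u, hu.1, hu.2⟩

lemma two_mul_count (q : ℕ) (hq : 2 ≤ q) (F : Type) [Field F] [Fintype F] [DecidableEq F]
    (hF : Fintype.card F = q ^ 2) (hadd : ∀ x y : F, (x + y) ^ q = x ^ q + y ^ q) :
    2 * Nat.card {α : F // ∃ u v : F, v ^ q + v = u ^ (q + 1) ∧ u ≠ 0 ∧ v ^ q ≠ v ∧
          α = u ^ 2 * v⁻¹} =
      (Finset.univ.filter (fun g : F => g ^ q + g = 1 ∧ g ^ q ≠ g)).card * (q + 1) := by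
  have hqq : ∀ x : F, (x ^ q) ^ q = x := fun x => by
    rw [← pow_mul, ← sq, ← hF, FiniteField.pow_card]
  obtain ⟨hM, hH⟩ := norm_one q hq F hF
  set G := Finset.univ.filter (fun g : F => g ^ q + g = 1 ∧ g ^ q ≠ g) with hG
  set M := Finset.univ.filter (fun w : F => w ^ (q + 1) = 1) with hMd
  have hmG : ∀ g, g ∈ G ↔ g ^ q + g = 1 ∧ g ^ q ≠ g := by simp [hG]
  have hmM : ∀ g, g ∈ M ↔ g ^ (q + 1) = 1 := by simp [hMd]
  have h0q : (0 : F) ^ q = 0 := zero_pow (by omega)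
  have hG0 : ∀ g ∈ G, g ≠ 0 := by
    rintro g hg rfl
    exact ((hmG _).1 hg).2 h0q
  have hM0 : ∀ g ∈ M, g ≠ 0 := by
    rintro g hg rfl
    have := (hmM _).1 hg
    simp at this
  let f : F × F → F := fun x => (x.1 * x.2)⁻¹
  have hset : ∀ α : F, (∃ u v : F, v ^ q + v = u ^ (q + 1) ∧ u ≠ 0 ∧ v ^ q ≠ v ∧
          α = u ^ 2 * v⁻¹) ↔ α ∈ (G ×ˢ M).image f := by
    intro α
    simp only [Finset.mem_image, Finset.mem_product, Prod.exists, hmG, hmM, f]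
    have hun : ∀ u : F, u ^ (q - 1) * u = u ^ q := fun u => by
      rw [← pow_succ]; congr 1; omega
    have hfix : ∀ u : F, (u ^ (q + 1)) ^ q = u ^ (q + 1) := fun u => by
      rw [pow_succ, mul_pow, hqq, mul_comm]
    constructor
    · rintro ⟨u, v, h, hu, hv, rfl⟩
      have hu' : u ^ (q + 1) ≠ 0 := pow_ne_zero _ hu
      have hv0 : v ≠ 0 := by rintro rfl; exact hv h0q
      refine ⟨v / u ^ (q + 1), u ^ (q - 1), ⟨⟨?_, ?_⟩, ?_⟩, ?_⟩
      · rw [div_pow, hfix, ← add_div, h, div_self hu']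
      · rw [div_pow, hfix]
        intro h'
        exact hv ((div_left_inj' hu').1 h')
      · rw [← pow_mul, ← FiniteField.pow_card_sub_one_eq_one u hu, hF]
        congr 1
        obtain ⟨n, rfl⟩ : ∃ n, q = n + 1 := ⟨q - 1, by omega⟩
        symm
        apply Nat.sub_eq_of_eq_add; simp; ring
      · have h1 : u ^ (q + 1) = u ^ (q - 1) * u ^ 2 := by
          rw [← pow_add]; congr 1; omega
        have h2 : u ^ (q - 1) ≠ 0 := pow_ne_zero _ hu
        rw [h1]
        field_simp
    · rintro ⟨g, w, ⟨⟨h1, h2⟩, hw⟩, rfl⟩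
      obtain ⟨u, hu, rfl⟩ := hH w hw
      have hu' : u ^ (q + 1) ≠ 0 := pow_ne_zero _ hu
      have hg0 : g ≠ 0 := by rintro rfl; exact h2 h0q
      refine ⟨u, g * u ^ (q + 1), ?_, hu, ?_, ?_⟩
      · rw [mul_pow, hfix, ← add_mul, h1, one_mul]
      · rw [mul_pow, hfix]
        intro h'
        exact h2 (mul_right_cancel₀ hu' h')
      · have h1 : u ^ (q + 1) = u ^ (q - 1) * u ^ 2 := by
          rw [← pow_add]; congr 1; omega
        have h2 : u ^ (q - 1) ≠ 0 := pow_ne_zero _ hu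
        rw [h1]
        field_simp
  have hcard : Nat.card {α : F // ∃ u v : F, v ^ q + v = u ^ (q + 1) ∧ u ≠ 0 ∧ v ^ q ≠ v ∧
          α = u ^ 2 * v⁻¹} = ((G ×ˢ M).image f).card := by
    rw [Nat.card_congr (Equiv.subtypeEquivRight hset), Nat.card_eq_fintype_card, Fintype.card_coe]
  rw [hcard, ← hM, ← Finset.card_product, Finset.card_eq_sum_card_image f (G ×ˢ M),
    Finset.sum_congr rfl (g := fun _ => 2), Finset.sum_const, smul_eq_mul, mul_comm]
  intro b hb
  obtain ⟨⟨g, w⟩, hgw, rfl⟩ := Finset.mem_image.1 hb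
  obtain ⟨hg, hw⟩ := Finset.mem_product.1 hgw
  simp only at hg hw
  have hg0 := hG0 g hg
  have hw0 := hM0 w hw
  obtain ⟨hg1, hg2⟩ := (hmG g).1 hg
  have hw1 := (hmM w).1 hw
  have hgq0 : g ^ q ≠ 0 := pow_ne_zero _ hg0
  have hne : ((g, w) : F × F) ≠ (g ^ q, g * w / g ^ q) := by
    intro h
    exact hg2 (Prod.ext_iff.1 h).1.symm
  rw [← Finset.card_pair hne]
  congr 1
  ext ⟨a, c⟩
  simp only [Finset.mem_filter, Finset.mem_product, Finset.mem_insert, Finset.mem_singleton, f,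
    inv_inj, Prod.mk.injEq]
  constructor
  · rintro ⟨⟨ha, hc⟩, h⟩
    have hc0 := hM0 c hc
    obtain ⟨ha1, ha2⟩ := (hmG a).1 ha
    have hc1 := (hmM c).1 hc
    have hn : a ^ (q + 1) = g ^ (q + 1) := by
      have := congrArg (· ^ (q + 1)) h
      simpa [mul_pow, hc1, hw1] using this
    have : (a - g) * (a - g ^ q) = 0 := by
      rw [pow_succ, pow_succ] at hn
      have e1 : a ^ q = 1 - a := by linear_combination ha1
      have e2 : g ^ q = 1 - g := by linear_combination hg1
      rw [e1, e2] at hn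
      rw [e2]
      linear_combination -hn
    rcases mul_eq_zero.1 this with h' | h'
    · left
      have : a = g := sub_eq_zero.1 h'
      subst this
      exact ⟨rfl, mul_left_cancel₀ hg0 h⟩
    · right
      have : a = g ^ q := sub_eq_zero.1 h'
      refine ⟨this, ?_⟩
      rw [eq_div_iff hgq0, ← this, mul_comm, h]
  · rintro (⟨rfl, rfl⟩ | ⟨rfl, rfl⟩)
    · exact ⟨⟨hg, hw⟩, rfl⟩
    · refine ⟨⟨?_, ?_⟩, ?_⟩
      · rw [hmG, hqq]
        exact ⟨by rw [add_comm]; exact hg1, hg2.symm⟩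
      · rw [hmM, div_pow, mul_pow, hw1, mul_one]
        have : (g ^ q) ^ (q + 1) = g ^ (q + 1) := by
          rw [pow_succ, hqq, pow_succ, mul_comm]
        rw [this, div_self (pow_ne_zero _ hg0)]
      · field_simp


/-- Lemma 5.4, count of conics: the number of values `α = u² v⁻¹` arising from points
`(u,v)` of the Hermitian curve with `u ≠ 0`, `v ∉ F_q` is `(q² - 1)/2` for odd `q`
and `(q² + q)/2` for even `q`. -/
theorem count_conics (q : ℕ) (hq : 2 ≤ q) (hpp : IsPrimePow q)
    (F : Type) [Field F] [Fintype F] (hF : Fintype.card F = q ^ 2) :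
    (Odd q →
      2 * (Nat.card {α : F // ∃ u v : F, v ^ q + v = u ^ (q + 1) ∧ u ≠ 0 ∧ v ^ q ≠ v ∧
          α = u ^ 2 * v⁻¹} : ℤ) = (q : ℤ) ^ 2 - 1) ∧
    (Even q →
      2 * (Nat.card {α : F // ∃ u v : F, v ^ q + v = u ^ (q + 1) ∧ u ≠ 0 ∧ v ^ q ≠ v ∧
          α = u ^ 2 * v⁻¹} : ℤ) = (q : ℤ) ^ 2 + (q : ℤ)) := by

  classical
  obtain ⟨p₀, k, hp₀, hk, hqp⟩ := hpp
  have hp₀' : p₀.Prime := hp₀.nat_prime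
  obtain ⟨p, hchar⟩ := CharP.exists F
  obtain ⟨n, hp, hn⟩ := FiniteField.card F p
  have hpp : p = p₀ := by
    have h1 : p ∣ q ^ 2 := by rw [← hF, hn]; exact dvd_pow_self p n.pos.ne'
    have h2 := hp.dvd_of_dvd_pow h1
    rw [← hqp] at h2
    exact (Nat.prime_dvd_prime_iff_eq hp hp₀').1 (hp.dvd_of_dvd_pow h2)
  subst hpp
  haveI : Fact p.Prime := ⟨hp⟩
  have hadd : ∀ x y : F, (x + y) ^ q = x ^ q + y ^ q := by
    intro x y
    rw [← hqp]; exact add_pow_char_pow x y p k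
  have hq0 : (q : F) = 0 := by
    rw [CharP.cast_eq_zero_iff F p, ← hqp]; exact dvd_pow_self p hk.ne'
  have hT := trace_fibre q hq F hF hadd
  have hcount := two_mul_count q hq F hF hadd
  constructor
  · intro hodd
    have h2 : (2 : F) ≠ 0 := by
      intro h
      obtain ⟨m, rfl⟩ := hodd
      push_cast at hq0
      rw [h] at hq0
      simp at hq0
    have hhalf : (2⁻¹ : F) ^ q = 2⁻¹ := by
      have h := hadd 2⁻¹ 2⁻¹
      have h3 : (2⁻¹ : F) + 2⁻¹ = 1 := by field_simp; norm_num
      rw [h3, one_pow] at h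
      apply eq_inv_of_mul_eq_one_left
      linear_combination -h
    have hG : (Finset.univ.filter (fun g : F => g ^ q + g = 1 ∧ g ^ q ≠ g)) =
        (Finset.univ.filter (fun g : F => g ^ q + g = 1)).erase 2⁻¹ := by
      ext g
      simp only [Finset.mem_filter, Finset.mem_univ, true_and, Finset.mem_erase]
      constructor
      · rintro ⟨h, h'⟩
        exact ⟨by rintro rfl; exact h' hhalf, h⟩
      · rintro ⟨h, h'⟩
        refine ⟨h', fun h3 => h ?_⟩
        rw [h3] at h'
        apply eq_inv_of_mul_eq_one_left
        linear_combination h'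
    rw [hG, Finset.card_erase_of_mem (by
      simp only [Finset.mem_filter, Finset.mem_univ, true_and]
      rw [hhalf]; field_simp; norm_num), hT] at hcount
    have h := congrArg (Nat.cast : ℕ → ℤ) hcount
    push_cast [Nat.cast_sub (show 1 ≤ q by omega)] at h
    rw [h]; ring
  · intro heven
    have h2 : (2 : F) = 0 := by
      rw [← hqp] at heven
      have h3 : 2 ∣ p := Nat.prime_two.dvd_of_dvd_pow heven.two_dvd
      have h4 : 2 = p := (Nat.prime_dvd_prime_iff_eq Nat.prime_two hp).1 h3
      have h5 := CharP.cast_eq_zero F p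
      rw [← h4] at h5
      exact_mod_cast h5
    have hG : (Finset.univ.filter (fun g : F => g ^ q + g = 1 ∧ g ^ q ≠ g)) =
        (Finset.univ.filter (fun g : F => g ^ q + g = 1)) := by
      apply Finset.filter_congr
      intro g _
      refine ⟨fun h => h.1, fun h => ⟨h, fun h' => ?_⟩⟩
      rw [h'] at h
      exact one_ne_zero (α := F) (by linear_combination -h + g * h2)
    rw [hG, hT] at hcount
    have h := congrArg (Nat.cast : ℕ → ℤ) hcount
    push_cast at h
    rw [h]; ring
end

section
/- The affine Hermitian curve has exactly q³ points: the set {(u,v) ∈ F × F : v^q + v = u^{q+1}} has cardinality q³. (Equivalently, the projective Hermitian curve has q³ + 1 rational points over F, one of which is the point at infinity.) -/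
lemma roots_ncard_le {F : Type} [Field F] (p : Polynomial F) (hp : p ≠ 0)
    (S : Set F) (hS : ∀ x ∈ S, p.eval x = 0) : Nat.card S ≤ p.natDegree := by
  classical
  have h1 : S ⊆ (p.roots.toFinset : Set F) := by
    intro x hx
    simp [hp, Polynomial.IsRoot, hS x hx]
  calc Nat.card S = S.ncard := Nat.card_coe_set_eq S
    _ ≤ (p.roots.toFinset : Set F).ncard := Set.ncard_le_ncard h1 (Finset.finite_toSet _)
    _ = p.roots.toFinset.card := Set.ncard_coe_finset _
    _ ≤ p.roots.card := Multiset.toFinset_card_le _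
    _ ≤ p.natDegree := p.card_roots'

/-- The affine Hermitian curve `y^q + y = x^(q+1)` over the field with `q²` elements
has exactly `q³` points. -/
theorem hermitian_card (q : ℕ) (hq : 2 ≤ q) (hpp : IsPrimePow q)
    (F : Type) [Field F] [Fintype F] (hF : Fintype.card F = q ^ 2) :
    Nat.card {p : F × F // p.2 ^ q + p.2 = p.1 ^ (q + 1)} = q ^ 3 := by
  have hfrob : ∀ x y : F, (x + y) ^ q = x ^ q + y ^ q := by
    obtain ⟨p, k, hp, hk, rfl⟩ := hpp
    have hp' : p.Prime := hp.nat_prime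
    have : Fact p.Prime := ⟨hp'⟩
    have : CharP F p := by
      obtain ⟨r, hr⟩ := CharP.exists F
      obtain ⟨n, hrp, hn⟩ := FiniteField.card F r
      have : p ∣ r ^ (n : ℕ) := by
        rw [← hn, hF]
        exact dvd_pow (dvd_pow_self p hk.ne') (by norm_num)
      have := (Nat.prime_dvd_prime_iff_eq hp' hrp).1 (hp'.dvd_of_dvd_pow this)
      rwa [this]
    intro x y
    exact add_pow_char_pow x y p k
  have hqq : ∀ x : F, (x ^ q) ^ q = x := by
    intro x
    rw [← pow_mul, ← sq, ← hF, FiniteField.pow_card]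
  let T : F →+ F :=
    { toFun := fun v => v ^ q + v
      map_zero' := by simp; omega
      map_add' := fun x y => by rw [hfrob]; ring }
  have hT : ∀ v, T v = v ^ q + v := fun v => rfl
  have hdeg1 : (Polynomial.X ^ q + Polynomial.X : Polynomial F).natDegree = q := by
    rw [Polynomial.natDegree_add_eq_left_of_natDegree_lt] <;> simp; omega
  have hdeg2 : (Polynomial.X ^ q - Polynomial.X : Polynomial F).natDegree = q := by
    rw [Polynomial.natDegree_sub_eq_left_of_natDegree_lt] <;> simp; omega
  have hne1 : (Polynomial.X ^ q + Polynomial.X : Polynomial F) ≠ 0 := by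
    intro h; rw [h] at hdeg1; simp at hdeg1; omega
  have hne2 : (Polynomial.X ^ q - Polynomial.X : Polynomial F) ≠ 0 := by
    intro h; rw [h] at hdeg2; simp at hdeg2; omega
  have hker : Nat.card T.ker ≤ q := by
    have := roots_ncard_le _ hne1 (T.ker : Set F) (by
      intro x hx
      have : T x = 0 := hx
      simpa [hT] using this)
    rwa [hdeg1] at this
  let S : Set F := {x | x ^ q = x}
  have hS : Nat.card S ≤ q := by
    have := roots_ncard_le _ hne2 S (by
      intro x hx
      have : x ^ q = x := hx
      simp [this])
    rwa [hdeg2] at this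
  have hRS : (T.range : Set F) ⊆ S := by
    rintro _ ⟨v, rfl⟩
    change (T v) ^ q = T v
    rw [hT, hfrob, hqq, add_comm]
  have hR : Nat.card T.range ≤ Nat.card S := Nat.card_mono S.toFinite hRS
  have hmul : Nat.card T.range * Nat.card T.ker = q ^ 2 := by
    rw [← hF, ← Nat.card_eq_fintype_card, ← AddSubgroup.index_ker T, AddSubgroup.index_mul_card]
  have hk : Nat.card T.ker = q := by nlinarith
  have hr : Nat.card T.range = q := by nlinarith
  have hEq : (T.range : Set F) = S := by
    apply Set.eq_of_subset_of_ncard_le hRS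
    rw [← Nat.card_coe_set_eq, ← Nat.card_coe_set_eq]
    exact hS.trans hr.ge
  have hex : ∀ u : F, ∃ v, v ^ q + v = u ^ (q + 1) := by
    intro u
    have h : u ^ (q + 1) ∈ S := by
      change (u ^ (q + 1)) ^ q = u ^ (q + 1)
      rw [pow_succ, mul_pow, hqq, mul_comm]
    rw [← hEq] at h
    exact h
  choose s hs using hex
  let e : {p : F × F // p.2 ^ q + p.2 = p.1 ^ (q + 1)} ≃ F × T.ker :=
    { toFun := fun p => (p.1.1, ⟨p.1.2 - s p.1.1, by
        rw [AddMonoidHom.mem_ker, map_sub, hT, hT, p.2, hs, sub_self]⟩)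
      invFun := fun x => ⟨(x.1, x.2.1 + s x.1), by
        have h : T x.2.1 = 0 := x.2.2
        change T (x.2.1 + s x.1) = _
        rw [map_add, h, zero_add, hT, hs]⟩
      left_inv := fun p => by ext <;> simp
      right_inv := fun x => by ext <;> simp }
  rw [Nat.card_congr e, Nat.card_prod, hk, Nat.card_eq_fintype_card, hF]
  ring
end
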